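/- arXiv:1903.07574 — 4 statements merged into one kernel-verified Lean document; each statement's English description precedes it below -/
import Mathlib

section
/- Let α ∈ ℂ. For every z ∈ ℂ with Re z > 0, the function s ↦ φ_α(s) e^{−sz} is integrable on [0,∞) and f_α(z) = ∫_0^∞ φ_α(s) e^{−sz} ds. -/
open MeasureTheory Filter Set Asymptotics

/-- The sequence of polynomials `p_n(α)` defined by `p_0(α) = 1` and
`p_{n+1}(α) = (α/(n+1)) · Σ_{k=0}^{n} ((k+1)/(k+2)) p_{n−k}(α)`. -/
noncomputable def bmpP {K : Type*} [Field K] (α : K) : ℕ → K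
  | 0 => 1
  | n + 1 => (α / (n + 1)) * ∑ k ∈ Finset.range (n + 1), ((k + 1 : K) / (k + 2)) * bmpP α (n - k)
  decreasing_by exact Nat.lt_succ_of_le (Nat.sub_le n k)

/-- The entire function `φ_α(s) = e^α Σ_{n≥0} (−1)^n p_{n+1}(α) s^n/n!`. -/
noncomputable def bmpPhi (α s : ℂ) : ℂ :=
  Complex.exp α * ∑' n : ℕ, (-1) ^ n * bmpP α (n + 1) * s ^ n / n.factorial

/-- `f_α(z) = e^α − exp(α z Log(1+1/z))`. -/
noncomputable def bmpF (α z : ℂ) : ℂ :=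
  Complex.exp α - Complex.exp (α * z * Complex.log (1 + 1 / z))

/-- The exponential generating function `s ↦ Σ b_n s^n / n!` of a sequence `b`. -/
noncomputable def borelSum (b : ℕ → ℂ) (s : ℂ) : ℂ := ∑' n : ℕ, b n * s ^ n / n.factorial

lemma norm_borel_term_le {b : ℕ → ℂ} {C R : ℝ} (hb : ∀ n, ‖b n‖ ≤ C * R ^ n) (s : ℂ) (n : ℕ) :
    ‖b n * s ^ n / n.factorial‖ ≤ C * ((R * ‖s‖) ^ n / n.factorial) := by
  rw [norm_div, norm_mul, norm_pow, Complex.norm_natCast, mul_pow, ← mul_div_assoc, ← mul_assoc]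
  gcongr
  exact hb n

lemma summable_norm_borel_term {b : ℕ → ℂ} {C R : ℝ} (hb : ∀ n, ‖b n‖ ≤ C * R ^ n) (s : ℂ) :
    Summable fun n : ℕ => ‖b n * s ^ n / n.factorial‖ :=
  .of_nonneg_of_le (fun _ => norm_nonneg _) (norm_borel_term_le hb s)
    ((Real.summable_pow_div_factorial _).mul_left C)

lemma norm_borelSum_le {b : ℕ → ℂ} {C R : ℝ} (hb : ∀ n, ‖b n‖ ≤ C * R ^ n) (s : ℂ) :
    ‖borelSum b s‖ ≤ C * Real.exp (R * ‖s‖) := by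
  have h := ((NormedSpace.expSeries_div_hasSum_exp (R * ‖s‖)).mul_left C)
  rw [← Real.exp_eq_exp_ℝ] at h
  exact tsum_of_norm_bounded h (norm_borel_term_le hb s)

lemma aestronglyMeasurable_borelSum {b : ℕ → ℂ} {C R : ℝ} (hb : ∀ n, ‖b n‖ ≤ C * R ^ n)
    (μ : Measure ℝ) : AEStronglyMeasurable (fun s : ℝ => borelSum b s) μ := by
  refine aestronglyMeasurable_of_tendsto_ae atTop
    (f := fun N (s : ℝ) => ∑ n ∈ Finset.range N, b n * (s : ℂ) ^ n / n.factorial)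
    (fun N => (by fun_prop : Continuous _).aestronglyMeasurable) ?_
  exact .of_forall fun s => (summable_norm_borel_term hb s).of_norm.hasSum.tendsto_sum_nat

lemma integrableOn_borelSum_mul_exp {b : ℕ → ℂ} {C R : ℝ} (hb : ∀ n, ‖b n‖ ≤ C * R ^ n)
    {z : ℂ} (hz : R < z.re) :
    IntegrableOn (fun s : ℝ => borelSum b s * Complex.exp (-(s : ℂ) * z)) (Ioi 0) := by
  refine Integrable.mono' ((exp_neg_integrableOn_Ioi 0 (sub_pos.2 hz)).const_mul C)
    ((aestronglyMeasurable_borelSum hb _).mul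
      (by fun_prop : Continuous _).aestronglyMeasurable) ?_
  filter_upwards [ae_restrict_mem measurableSet_Ioi] with s hs
  rw [norm_mul, Complex.norm_exp]
  have h1 := norm_borelSum_le hb s
  rw [Complex.norm_real, Real.norm_of_nonneg (le_of_lt hs)] at h1
  calc _ ≤ C * Real.exp (R * s) * Real.exp (-(s : ℂ) * z).re := by gcongr
    _ = _ := by
      rw [mul_assoc, ← Real.exp_add]
      simp
      left; ring

lemma norm_pow_mul_exp_neg {s : ℝ} (hs : 0 ≤ s) (z : ℂ) (n : ℕ) :
    ‖(s : ℂ) ^ n * Complex.exp (-(s : ℂ) * z)‖ = s ^ n * Real.exp (-z.re * s) := by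
  simp [Complex.norm_exp, abs_of_nonneg hs, mul_comm]

lemma integrableOn_pow_mul_exp_neg {z : ℂ} (hz : 0 < z.re) (n : ℕ) :
    IntegrableOn (fun s : ℝ => (s : ℂ) ^ n * Complex.exp (-(s : ℂ) * z)) (Ioi 0) := by
  have h := integrableOn_rpow_mul_exp_neg_mul_rpow (s := n) (p := 1) (b := z.re)
    (by linarith [n.cast_nonneg (α := ℝ)]) one_pos hz
  simp only [Real.rpow_natCast, Real.rpow_one] at h
  refine Integrable.mono' h (by fun_prop : Continuous _).aestronglyMeasurable ?_
  filter_upwards [ae_restrict_mem measurableSet_Ioi] with s hs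
  exact (norm_pow_mul_exp_neg (le_of_lt hs) z n).le

lemma integral_pow_mul_exp_neg {z : ℂ} (hz : 0 < z.re) (n : ℕ) :
    ∫ s in Ioi (0 : ℝ), (s : ℂ) ^ n * Complex.exp (-(s : ℂ) * z) = n.factorial / z ^ (n + 1) := by
  have hz0 : z ≠ 0 := by rintro rfl; simp at hz
  induction n with
  | zero =>
    have h := integral_exp_mul_complex_Ioi (a := -z) (by simpa using hz) 0
    simpa [neg_div, mul_comm z] using h
  | succ n ih =>
    have hd : ∀ s ∈ Ici (0 : ℝ), HasDerivAt
        (fun s : ℝ => (s : ℂ) ^ (n + 1) * Complex.exp (-(s : ℂ) * z))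
        ((n + 1) * ((s : ℂ) ^ n * Complex.exp (-(s : ℂ) * z)) -
          z * ((s : ℂ) ^ (n + 1) * Complex.exp (-(s : ℂ) * z))) s := by
      intro s _
      have h1 : HasDerivAt (fun w : ℂ => w ^ (n + 1) * Complex.exp (-w * z)) _ (s : ℂ) :=
        (hasDerivAt_pow (n + 1) _).mul (((hasDerivAt_neg _).mul_const z).cexp)
      convert! h1.comp_ofReal using 1
      simp
      ring
    have hi0 := (integrableOn_pow_mul_exp_neg hz n).const_mul (n + 1 : ℂ)
    have hi1 := (integrableOn_pow_mul_exp_neg hz (n + 1)).const_mul z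
    have ht : Tendsto (fun s : ℝ => (s : ℂ) ^ (n + 1) * Complex.exp (-(s : ℂ) * z)) atTop
        (nhds 0) := by
      refine squeeze_zero_norm' ?_
        (tendsto_rpow_mul_exp_neg_mul_atTop_nhds_zero (n + 1 : ℕ) z.re hz)
      filter_upwards [eventually_ge_atTop 0] with s hs
      rw [norm_pow_mul_exp_neg hs, Real.rpow_natCast]
    have h := integral_Ioi_of_hasDerivAt_of_tendsto' hd (hi0.sub hi1) ht
    rw [integral_sub hi0 hi1, integral_const_mul, integral_const_mul, ih] at h
    simp only [Complex.ofReal_zero, zero_pow n.succ_ne_zero, zero_mul, sub_zero, sub_eq_zero] at h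
    rw [eq_div_iff (by positivity), pow_succ, mul_comm, mul_assoc, ← h, Nat.factorial_succ]
    push_cast
    field_simp

lemma hasSum_laplace_borelSum {b : ℕ → ℂ} {C R : ℝ} (hR : 0 ≤ R) (hb : ∀ n, ‖b n‖ ≤ C * R ^ n)
    {z : ℂ} (hz : R < z.re) :
    HasSum (fun n => b n / z ^ (n + 1))
      (∫ s in Ioi (0 : ℝ), borelSum b s * Complex.exp (-(s : ℂ) * z)) := by
  have hz0 := hR.trans_lt hz
  have key := hasSum_integral_of_summable_integral_norm (μ := volume.restrict (Ioi (0 : ℝ)))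
    (F := fun n s => b n / n.factorial * ((s : ℂ) ^ n * Complex.exp (-(s : ℂ) * z)))
    (fun n => (integrableOn_pow_mul_exp_neg hz0 n).const_mul _) ?_
  · convert! key using 1
    · ext n
      rw [integral_const_mul, integral_pow_mul_exp_neg hz0]
      have : (n.factorial : ℂ) ≠ 0 := by exact_mod_cast n.factorial_ne_zero
      field_simp
    · congr 1 with s
      rw [borelSum, ← tsum_mul_right]
      exact tsum_congr fun n => by ring
  · have hn : ∀ n, ∫ s in Ioi (0 : ℝ),
        ‖b n / n.factorial * ((s : ℂ) ^ n * Complex.exp (-(s : ℂ) * z))‖ =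
        ‖b n‖ / z.re ^ (n + 1) := by
      intro n
      have h1 := integral_pow_mul_exp_neg (z := z.re) (by simpa using hz0) n
      have h2 : ∫ s in Ioi (0 : ℝ), s ^ n * Real.exp (-s * z.re) =
          n.factorial / z.re ^ (n + 1) := by
        rw [← Complex.ofReal_inj, ← integral_complex_ofReal]
        push_cast
        exact h1
      have : (n.factorial : ℝ) ≠ 0 := by exact_mod_cast n.factorial_ne_zero
      calc _ = ∫ s in Ioi (0 : ℝ), ‖b n‖ / n.factorial * (s ^ n * Real.exp (-s * z.re)) := by
            refine setIntegral_congr_fun measurableSet_Ioi fun s hs => ?_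
            have hs' : |s| = s := abs_of_pos hs
            simp [Complex.norm_exp, hs']
        _ = _ := by
            rw [integral_const_mul, h2]
            field_simp
    simp only [hn]
    refine .of_nonneg_of_le (fun n => by positivity) (fun n => ?_)
      ((summable_geometric_of_lt_one (div_nonneg hR hz0.le)
        ((div_lt_one hz0).2 hz)).mul_left (C / z.re))
    calc _ ≤ C * R ^ n / z.re ^ (n + 1) := by gcongr; exact hb n
      _ = _ := by rw [div_pow, pow_succ]; field_simp

lemma iteratedDeriv_eq_of_frequently_tsum_eq {f : ℂ → ℂ} (hf : AnalyticAt ℂ f 0) {c : ℕ → ℂ}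
    {C R : ℝ} (hR : 0 < R) (hc : ∀ n, ‖c n‖ ≤ C * R ^ n)
    (h : ∃ᶠ x in nhdsWithin (0 : ℂ) {0}ᶜ, ∑' n, c n * x ^ n = f x) (n : ℕ) :
    iteratedDeriv n f 0 = n.factorial * c n := by
  have hrad : 0 < (FormalMultilinearSeries.ofScalars ℂ c).radius := by
    refine lt_of_lt_of_le ?_ ((FormalMultilinearSeries.ofScalars ℂ c).le_radius_of_bound C
      (r := ⟨R⁻¹, by positivity⟩) fun n => ?_)
    · exact ENNReal.coe_pos.2 (show (0 : ℝ) < R⁻¹ by positivity)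
    · rw [FormalMultilinearSeries.ofScalars_norm]
      calc _ ≤ C * R ^ n * R⁻¹ ^ n := mul_le_mul_of_nonneg_right (hc n) (by positivity)
        _ = C := by rw [mul_assoc, ← mul_pow, mul_inv_cancel₀ hR.ne']; simp
  have h1 := ((FormalMultilinearSeries.ofScalars ℂ c).hasFPowerSeriesOnBall hrad).hasFPowerSeriesAt
  have h2 : FormalMultilinearSeries.ofScalarsSum c =ᶠ[nhds 0] f := by
    refine (AnalyticAt.frequently_eq_iff_eventually_eq h1.analyticAt hf).1 (h.mono fun x hx => ?_)
    rw [← hx]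
    exact FormalMultilinearSeries.ofScalars_sum_eq c x
  have h3 := (h1.congr h2).eq_formalMultilinearSeries hf.hasFPowerSeriesAt
  have h4 := congrFun (FormalMultilinearSeries.ofScalars_series_injective ℂ ℂ h3) n
  have : (n.factorial : ℂ) ≠ 0 := by exact_mod_cast n.factorial_ne_zero
  rw [h4]
  field_simp

lemma exists_norm_taylor_coeff_le {f : ℂ → ℂ} {ρ r : ℝ} (hf : DifferentiableOn ℂ f (Metric.ball 0 ρ))
    (hr : 0 < r) (hrρ : r < ρ) :
    ∃ C, ∀ n : ℕ, ‖iteratedDeriv n f 0 / n.factorial‖ ≤ C * r⁻¹ ^ n := by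
  have h := (Complex.hasSum_taylorSeries_on_ball hf (z := r)
    (by simpa [abs_of_pos hr] using hrρ)).summable.tendsto_atTop_zero
  obtain ⟨C, hC⟩ := h.norm.bddAbove_range
  refine ⟨C, fun n => ?_⟩
  have := hC ⟨n, rfl⟩
  simp [abs_of_pos hr] at this ⊢
  rw [← div_eq_mul_inv, le_div_iff₀ (by positivity)]
  calc _ = _ := by ring
    _ ≤ _ := this

/-- The removable-singularity extension of `u ↦ log (1 + u) / u` to `u = 0`. -/
noncomputable def logSlope : ℂ → ℂ := dslope (fun u => Complex.log (1 + u)) 0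

lemma logSlope_of_ne {u : ℂ} (hu : u ≠ 0) : logSlope u = Complex.log (1 + u) / u := by
  rw [logSlope, dslope_of_ne _ hu, slope_def_field]
  simp

lemma isOpen_one_add_mem_slitPlane : IsOpen {u : ℂ | 1 + u ∈ Complex.slitPlane} :=
  Complex.isOpen_slitPlane.preimage (by fun_prop)

lemma differentiableOn_logSlope :
    DifferentiableOn ℂ logSlope {u : ℂ | 1 + u ∈ Complex.slitPlane} := by
  refine (Complex.differentiableOn_dslope
    (isOpen_one_add_mem_slitPlane.mem_nhds (by simp))).2 fun u hu => ?_
  exact ((differentiableAt_id.const_add 1).clog hu).differentiableWithinAt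

lemma analyticAt_logSlope : AnalyticAt ℂ logSlope 0 :=
  differentiableOn_logSlope.analyticAt (isOpen_one_add_mem_slitPlane.mem_nhds (by simp))

lemma iteratedDeriv_logSlope (n : ℕ) :
    iteratedDeriv n logSlope 0 = n.factorial * ((-1) ^ n / (n + 1)) := by
  refine iteratedDeriv_eq_of_frequently_tsum_eq analyticAt_logSlope (C := 1) one_pos
    (c := fun n : ℕ => (-1) ^ n / ((n : ℂ) + 1)) (fun n => ?_) ?_ n
  · rw [norm_div, norm_pow, norm_neg, norm_one, one_pow, mul_one]
    refine div_le_one_of_le₀ ?_ (norm_nonneg _)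
    rw [← Nat.cast_succ, Complex.norm_natCast]
    simp
  · refine Filter.Eventually.frequently ?_
    filter_upwards [self_mem_nhdsWithin,
      mem_nhdsWithin_of_mem_nhds (Metric.ball_mem_nhds (0 : ℂ) one_pos)] with x hx hx1
    have h := Complex.hasSum_taylorSeries_log (z := x) (by simpa using hx1)
    rw [← hasSum_nat_add_iff' 1] at h
    have h2 := h.div_const x
    rw [logSlope_of_ne hx]
    simp only [Finset.range_one, Finset.sum_singleton, Nat.cast_zero, div_zero, sub_zero] at h2
    rw [← h2.tsum_eq]
    refine tsum_congr fun n => ?_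
    have hx' : x ≠ 0 := hx
    have : (n : ℂ) + 1 ≠ 0 := Nat.cast_add_one_ne_zero n
    push_cast
    field_simp
    ring

lemma logSlope_zero : logSlope 0 = 1 := by
  simpa using iteratedDeriv_logSlope 0

lemma analyticAt_exp_logSlope (α : ℂ) :
    AnalyticAt ℂ (fun u => Complex.exp (α * logSlope u)) 0 :=
  (analyticAt_const.mul analyticAt_logSlope).cexp

lemma iteratedDeriv_exp_logSlope (α : ℂ) (n : ℕ) :
    iteratedDeriv n (fun u => Complex.exp (α * logSlope u)) 0 =
      Complex.exp α * (-1) ^ n * n.factorial * bmpP α n := by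
  induction n using Nat.strong_induction_on with
  | _ n ih =>
  cases n with
  | zero => simp [bmpP, logSlope_zero]
  | succ n =>
    have hd : deriv (fun u => Complex.exp (α * logSlope u)) =ᶠ[nhds 0]
        fun u => α * ((fun u => Complex.exp (α * logSlope u)) * deriv logSlope) u := by
      filter_upwards [analyticAt_logSlope.eventually_analyticAt] with u hu
      have h := (hu.differentiableAt.hasDerivAt.const_mul α).cexp
      rw [h.deriv, Pi.mul_apply]
      ring
    rw [iteratedDeriv_succ', hd.iteratedDeriv_eq n, iteratedDeriv_const_mul_field,
      iteratedDeriv_mul (analyticAt_exp_logSlope α).contDiffAt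
        analyticAt_logSlope.deriv.contDiffAt, bmpP, ← Finset.sum_range_reflect,
      Finset.mul_sum, Finset.mul_sum, Finset.mul_sum]
    refine Finset.sum_congr rfl fun k hk => ?_
    have hkn : k ≤ n := Nat.lt_succ_iff.1 (Finset.mem_range.1 hk)
    simp only [Nat.add_sub_cancel]
    rw [Nat.sub_sub_self hkn, ih (n - k) (by omega), ← iteratedDeriv_succ',
      iteratedDeriv_logSlope, Nat.choose_symm hkn, Nat.cast_choose ℂ hkn]
    have h1 : ((n - k).factorial : ℂ) ≠ 0 := by exact_mod_cast Nat.factorial_ne_zero _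
    have h2 : (k.factorial : ℂ) ≠ 0 := by exact_mod_cast Nat.factorial_ne_zero _
    have h3 : (n : ℂ) + 1 ≠ 0 := Nat.cast_add_one_ne_zero n
    have h4 : (k : ℂ) + 2 ≠ 0 := by exact_mod_cast (k + 1).succ_ne_zero
    have h5 : (k : ℂ) + 1 + 1 ≠ 0 := by exact_mod_cast (k + 1).succ_ne_zero
    have h6 : (-1 : ℂ) ^ (n + 1) = (-1) ^ (n - k) * (-1) ^ (k + 1) := by
      rw [← pow_add]; congr 1; omega
    rw [h6, Nat.factorial_succ, Nat.factorial_succ]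
    push_cast
    rw [show (k : ℂ) + 1 + 1 = k + 2 by ring]
    field_simp

/-- `f_α` in the variable `u = 1 / z`, extended holomorphically across `u = 0`. -/
noncomputable def bmpFInv (α u : ℂ) : ℂ := Complex.exp α - Complex.exp (α * logSlope u)

lemma bmpF_eq_bmpFInv (α : ℂ) {z : ℂ} (hz : z ≠ 0) : bmpF α z = bmpFInv α (1 / z) := by
  rw [bmpF, bmpFInv, logSlope_of_ne (one_div_ne_zero hz)]
  congr 2
  field_simp

lemma bmpFInv_zero (α : ℂ) : bmpFInv α 0 = 0 := by simp [bmpFInv, logSlope_zero]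

lemma analyticAt_bmpFInv (α : ℂ) : AnalyticAt ℂ (bmpFInv α) 0 :=
  analyticAt_const.sub (analyticAt_exp_logSlope α)

lemma iteratedDeriv_succ_bmpFInv (α : ℂ) (n : ℕ) :
    iteratedDeriv (n + 1) (bmpFInv α) 0 =
      (n + 1).factorial * (Complex.exp α * (-1) ^ n * bmpP α (n + 1)) := by
  have h : bmpFInv α = fun u => Complex.exp α - (fun u => Complex.exp (α * logSlope u)) u := rfl
  rw [h, iteratedDeriv_const_sub n.succ_pos, iteratedDeriv_neg, iteratedDeriv_exp_logSlope,
    Nat.succ_eq_add_one]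
  ring

/-- `f_α (1 / w - 1 / 2)` as a function of `w`, which is holomorphic on the disc `|w| < 2`. -/
noncomputable def bmpFShift (α w : ℂ) : ℂ := bmpFInv α (w / (1 - w / 2))

lemma differentiableOn_bmpFShift (α : ℂ) :
    DifferentiableOn ℂ (bmpFShift α) (Metric.ball 0 2) := by
  have hne : ∀ w ∈ Metric.ball (0 : ℂ) 2, 1 - w / 2 ≠ 0 := by
    intro w hw h
    have : w = 2 := by linear_combination -2 * h
    simp [this] at hw
  have hl : DifferentiableOn ℂ (fun w => logSlope (w / (1 - w / 2))) (Metric.ball 0 2) := by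
    refine differentiableOn_logSlope.comp (fun w hw => ?_) fun w hw => ?_
    · exact (differentiableAt_fun_id.fun_div (c := fun w => w) (d := fun w : ℂ => 1 - w / 2)
        (by fun_prop) (hne w hw)).differentiableWithinAt
    · have h1 : 1 + w / (1 - w / 2) = (1 + w / 2) / (1 - w / 2) := by
        rw [eq_div_iff (hne w hw), add_mul, div_mul_cancel₀ _ (hne w hw)]
        ring
      have hw2 : Complex.normSq w < 4 := by
        rw [Complex.normSq_eq_norm_sq]
        have : ‖w‖ < 2 := by simpa using hw
        nlinarith [norm_nonneg w]
      rw [Complex.normSq_apply] at hw2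
      refine Or.inl ?_
      have hpos : 0 < Complex.normSq (1 - w / 2) := Complex.normSq_pos.2 (hne w hw)
      rw [h1, Complex.div_re, ← add_div]
      refine div_pos ?_ hpos
      simp
      nlinarith
  exact ((hl.const_mul α).cexp).const_sub _

/-- The Laurent coefficients of `f_α` about `-1/2`. -/
noncomputable def bmpShiftCoeff (α : ℂ) (n : ℕ) : ℂ :=
  iteratedDeriv (n + 1) (bmpFShift α) 0 / (n + 1).factorial

lemma exists_norm_bmpShiftCoeff_le (α : ℂ) {R : ℝ} (hR : 1 / 2 < R) :
    ∃ C, ∀ n, ‖bmpShiftCoeff α n‖ ≤ C * R ^ n := by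
  have hR0 : 0 < R := by linarith
  obtain ⟨C, hC⟩ := exists_norm_taylor_coeff_le (differentiableOn_bmpFShift α) (inv_pos.2 hR0)
    (by rw [inv_lt_comm₀ hR0 two_pos]; linarith)
  refine ⟨C * R, fun n => (hC (n + 1)).trans_eq ?_⟩
  rw [inv_inv, pow_succ']
  ring

lemma hasSum_bmpShiftCoeff (α : ℂ) {w : ℂ} (hw : ‖w‖ < 2) :
    HasSum (fun n => bmpShiftCoeff α n * w ^ (n + 1)) (bmpFShift α w) := by
  have h := Complex.hasSum_taylorSeries_on_ball (differentiableOn_bmpFShift α) (z := w)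
    (by simpa using hw)
  rw [← hasSum_nat_add_iff' 1] at h
  convert! h using 1
  · ext n
    simp [bmpShiftCoeff]
    ring
  · simp [bmpFShift, bmpFInv_zero]

lemma integral_borelSum_bmpShiftCoeff (α : ℂ) {z : ℂ} (hz : 0 < z.re) :
    ∫ s in Ioi (0 : ℝ), borelSum (bmpShiftCoeff α) s * Complex.exp (-(s : ℂ) * (z + 1 / 2)) =
      bmpF α z := by
  have hre : (z + 1 / 2).re = z.re + 1 / 2 := by simp
  obtain ⟨C, hC⟩ := exists_norm_bmpShiftCoeff_le α (R := z.re / 2 + 1 / 2) (by linarith)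
  have hz0 : z ≠ 0 := by rintro rfl; simp at hz
  have hz1 : z + 1 / 2 ≠ 0 := by
    intro h
    rw [h] at hre
    simp at hre
    linarith
  have h1 := hasSum_laplace_borelSum (by positivity) hC (z := z + 1 / 2) (by rw [hre]; linarith)
  have h2 := hasSum_bmpShiftCoeff α (w := 1 / (z + 1 / 2)) (by
    have := Complex.re_le_norm (z + 1 / 2)
    rw [norm_div, norm_one, div_lt_iff₀ (norm_pos_iff.2 hz1)]
    linarith)
  have h3 : bmpFShift α (1 / (z + 1 / 2)) = bmpF α z := by
    rw [bmpFShift, bmpF_eq_bmpFInv α hz0]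
    congr 1
    have h4 : 1 - 1 / (z + 1 / 2) / 2 = z / (z + 1 / 2) := by
      rw [eq_div_iff hz1, sub_mul, div_right_comm, div_mul_cancel₀ _ hz1]
      ring
    rw [h4, div_div_div_cancel_right₀ hz1]
  rw [← h3, ← h2.tsum_eq, ← h1.tsum_eq]
  simp [div_eq_mul_inv]

/-- The binomial convolution of two sequences. -/
noncomputable def binomialConv (a b : ℕ → ℂ) (n : ℕ) : ℂ :=
  ∑ k ∈ Finset.range (n + 1), n.choose k * a k * b (n - k)

lemma norm_binomialConv_le {a b : ℕ → ℂ} {C R D S : ℝ} (ha : ∀ n, ‖a n‖ ≤ C * R ^ n)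
    (hb : ∀ n, ‖b n‖ ≤ D * S ^ n) (n : ℕ) :
    ‖binomialConv a b n‖ ≤ C * D * (R + S) ^ n := by
  rw [add_pow, Finset.mul_sum]
  refine norm_sum_le_of_le _ fun k _ => ?_
  rw [norm_mul, norm_mul, Complex.norm_natCast]
  calc _ ≤ n.choose k * (C * R ^ k) * (D * S ^ (n - k)) :=
        mul_le_mul (mul_le_mul_of_nonneg_left (ha k) (by positivity)) (hb _) (norm_nonneg _)
          (mul_nonneg (by positivity) ((norm_nonneg _).trans (ha k)))
    _ = _ := by ring

lemma borelSum_mul_borelSum {a b : ℕ → ℂ} {C R D S : ℝ} (ha : ∀ n, ‖a n‖ ≤ C * R ^ n)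
    (hb : ∀ n, ‖b n‖ ≤ D * S ^ n) (s : ℂ) :
    borelSum a s * borelSum b s = borelSum (binomialConv a b) s := by
  rw [borelSum, borelSum, tsum_mul_tsum_eq_tsum_sum_range_of_summable_norm
    (summable_norm_borel_term ha s) (summable_norm_borel_term hb s), borelSum]
  refine tsum_congr fun n => ?_
  rw [binomialConv, Finset.sum_mul, Finset.sum_div]
  refine Finset.sum_congr rfl fun k hk => ?_
  have hkn : k ≤ n := Nat.lt_succ_iff.1 (Finset.mem_range.1 hk)
  have h0 : (n.factorial : ℂ) ≠ 0 := by exact_mod_cast Nat.factorial_ne_zero _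
  rw [Nat.cast_choose ℂ hkn, ← pow_mul_pow_sub s hkn]
  field_simp

lemma borelSum_pow (a s : ℂ) : borelSum (fun n => a ^ n) s = Complex.exp (a * s) := by
  rw [Complex.exp_eq_exp_ℂ, NormedSpace.exp_eq_tsum_div]
  simp [borelSum, mul_pow]

lemma binomialConv_bmpShiftCoeff (α : ℂ) (n : ℕ) :
    binomialConv (bmpShiftCoeff α) (fun n => (-1 / 2) ^ n) n =
      Complex.exp α * (-1) ^ n * bmpP α (n + 1) := by
  obtain ⟨C, hC⟩ := exists_norm_bmpShiftCoeff_le α (R := 1) (by norm_num)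
  have hE : ∀ n : ℕ, ‖(-1 / 2 : ℂ) ^ n‖ ≤ 1 * 1 ^ n := fun n => by
    rw [norm_pow, one_pow, mul_one]
    exact pow_le_one₀ (norm_nonneg _) (by norm_num)
  set c := binomialConv (bmpShiftCoeff α) fun n => (-1 / 2) ^ n with hc
  have hcb := norm_binomialConv_le hC hE
  rw [← hc, one_add_one_eq_two, mul_one] at hcb
  have hC0 : 0 ≤ C := by simpa using (norm_nonneg _).trans (hC 0)
  have hfreq : ∃ᶠ x in nhdsWithin (0 : ℂ) {0}ᶜ,
      ∑' n, (Nat.casesOn n 0 c : ℂ) * x ^ n = bmpFInv α x := by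
    have ht : Tendsto (fun t : ℝ => ((t : ℂ))⁻¹) atTop (nhdsWithin (0 : ℂ) {0}ᶜ) := by
      refine tendsto_nhdsWithin_iff.2 ⟨?_, ?_⟩
      · simpa using (tendsto_inv_atTop_zero (𝕜 := ℝ)).ofReal
      · filter_upwards [eventually_gt_atTop 0] with t ht
        simpa using ht.ne'
    refine ht.frequently (Filter.Eventually.frequently ?_)
    filter_upwards [eventually_gt_atTop 2] with t ht2
    have h1 := hasSum_laplace_borelSum two_pos.le hcb (z := t) (by simpa using ht2)
    have h2 : ∀ s : ℝ, borelSum c s * Complex.exp (-(s : ℂ) * t) =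
        borelSum (bmpShiftCoeff α) s * Complex.exp (-(s : ℂ) * (t + 1 / 2)) := fun s => by
      rw [hc, ← borelSum_mul_borelSum hC hE, borelSum_pow, mul_assoc, ← Complex.exp_add]
      ring_nf
    have ht0 : 0 < t := by linarith
    simp only [h2] at h1
    rw [integral_borelSum_bmpShiftCoeff α (by simpa using ht0),
      bmpF_eq_bmpFInv α (by exact_mod_cast ht0.ne'), one_div] at h1
    refine HasSum.tsum_eq ?_
    rw [← hasSum_nat_add_iff' 1]
    simpa [div_eq_mul_inv] using h1
  have h := iteratedDeriv_eq_of_frequently_tsum_eq (analyticAt_bmpFInv α) (C := C) two_pos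
    (fun n => ?_) hfreq (n + 1)
  · rw [iteratedDeriv_succ_bmpFInv] at h
    exact (mul_left_cancel₀ (by exact_mod_cast Nat.factorial_ne_zero _) h).symm
  · cases n with
    | zero => simpa using hC0
    | succ n => exact (hcb n).trans (by gcongr <;> simp)

lemma bmpPhi_eq_borelSum (α s : ℂ) :
    bmpPhi α s = borelSum (bmpShiftCoeff α) s * Complex.exp (-1 / 2 * s) := by
  obtain ⟨C, hC⟩ := exists_norm_bmpShiftCoeff_le α (R := 1) (by norm_num)
  rw [← borelSum_pow, borelSum_mul_borelSum hC (D := 1) (S := 1 / 2) fun n => by simp]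
  simp only [borelSum, binomialConv_bmpShiftCoeff, bmpPhi, ← tsum_mul_left]
  exact tsum_congr fun n => by ring

/-- For `Re z > 0`, `s ↦ φ_α(s) e^{−sz}` is integrable on `[0,∞)` and
`f_α(z) = ∫_0^∞ φ_α(s) e^{−sz} ds`. -/
theorem stmt2 (α z : ℂ) (hz : 0 < z.re) :
    IntegrableOn (fun s : ℝ => bmpPhi α s * Complex.exp (-(s : ℂ) * z)) (Set.Ici 0) ∧
    bmpF α z = ∫ s in Set.Ioi (0 : ℝ), bmpPhi α s * Complex.exp (-(s : ℂ) * z) := by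
  have hphi : ∀ s : ℝ, bmpPhi α s * Complex.exp (-(s : ℂ) * z) =
      borelSum (bmpShiftCoeff α) s * Complex.exp (-(s : ℂ) * (z + 1 / 2)) := fun s => by
    rw [bmpPhi_eq_borelSum, mul_assoc, ← Complex.exp_add]
    ring_nf
  simp only [hphi]
  obtain ⟨C, hC⟩ := exists_norm_bmpShiftCoeff_le α (R := z.re / 2 + 1 / 2) (by linarith)
  refine ⟨?_, (integral_borelSum_bmpShiftCoeff α hz).symm⟩
  rw [integrableOn_Ici_iff_integrableOn_Ioi]
  exact integrableOn_borelSum_mul_exp hC (by simp; linarith)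
end

section
/- Let α ∈ ℝ, α > 0. The function f_α : (0,∞) → ℝ, f_α(x) = e^α − (1+1/x)^{αx}, is completely monotonic if and only if φ_α(s) ≥ 0 for all s ≥ 0. Moreover, if this holds, then φ_α is integrable on [0,∞) and ∫_0^∞ φ_α(s) ds = e^α − 1. -/
open MeasureTheory Filter Set Asymptotics

/-- The real function `φ_α(s) = e^α Σ_{n≥0} (−1)^n p_{n+1}(α) s^n/n!` for real `α`. -/
noncomputable def bmpPhiR (α s : ℝ) : ℝ :=
  Real.exp α * ∑' n : ℕ, (-1) ^ n * bmpP α (n + 1) * s ^ n / n.factorial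

/-- A function `f : (0,∞) → ℝ` is completely monotonic: it is infinitely differentiable on
`(0,∞)` and `(−1)^n f^{(n)}(x) ≥ 0` for all `x > 0` and all `n ≥ 0`. -/
def CompletelyMonotonicOn (f : ℝ → ℝ) : Prop :=
  ContDiffOn ℝ (⊤ : ℕ∞) f (Set.Ioi 0) ∧
    ∀ (n : ℕ), ∀ x ∈ Set.Ioi (0 : ℝ), 0 ≤ (-1 : ℝ) ^ n * iteratedDerivWithin n f (Set.Ioi 0) x

open scoped Topology

lemma integrable_of_hasSum_of_summable_integral_norm {X : Type*} [MeasurableSpace X]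
    {μ : Measure X} {F : ℕ → X → ℝ} {g : X → ℝ} (hF : ∀ i, Integrable (F i) μ)
    (hsum : Summable fun i => ∫ a, ‖F i a‖ ∂μ) (hg : ∀ᵐ a ∂μ, HasSum (fun i => F i a) (g a)) :
    Integrable g μ := by
  refine ⟨aestronglyMeasurable_of_tendsto_ae atTop
    (f := fun N a => ∑ i ∈ Finset.range N, F i a) (fun N => ?_) ?_, ?_⟩
  · exact (integrable_finsetSum _ fun i _ => hF i).aestronglyMeasurable
  · filter_upwards [hg] with a ha using ha.tendsto_sum_nat
  · have hle : ∀ᵐ a ∂μ, ‖g a‖ₑ ≤ ∑' i, ‖F i a‖ₑ := by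
      filter_upwards [hg] with a ha
      rw [← ha.tsum_eq]
      exact enorm_tsum_le_tsum_enorm
    refine (lintegral_mono_ae hle).trans_lt ?_
    rw [lintegral_tsum fun i => (hF i).aestronglyMeasurable.enorm]
    have h (i : ℕ) : ∫⁻ a, ‖F i a‖ₑ ∂μ = ENNReal.ofReal (∫ a, ‖F i a‖ ∂μ) :=
      (ofReal_integral_norm_eq_lintegral_enorm (hF i)).symm
    simp_rw [h]
    rw [← ENNReal.ofReal_tsum_of_nonneg (fun i => integral_nonneg fun a => norm_nonneg _) hsum]
    exact ENNReal.ofReal_lt_top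

/-- The `n`-th derivative, up to the sign `(-1) ^ n`, of `∑ a k * x ^ (-(k + 1))`. -/
noncomputable def inverseSeries (a : ℕ → ℝ) (n : ℕ) (x : ℝ) : ℝ :=
  ∑' k, a k * ((k + n).descFactorial n : ℝ) * x⁻¹ ^ (k + n + 1)

section Growth

variable {a : ℕ → ℝ} {M R : ℝ}

lemma norm_inverseSeries_term_le (ha : ∀ k, |a k| ≤ M * R ^ k) (n k : ℕ) {y : ℝ} (hy : 0 ≤ y) :
    ‖a k * ((k + n).descFactorial n : ℝ) * y ^ (k + n + 1)‖ ≤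
      M * y ^ (n + 1) * (((k + n).descFactorial n : ℝ) * (R * y) ^ k) := by
  rw [norm_mul, norm_mul, Real.norm_eq_abs, Real.norm_of_nonneg (by positivity),
    Real.norm_of_nonneg (by positivity)]
  calc _ ≤ M * R ^ k * ((k + n).descFactorial n : ℝ) * y ^ (k + n + 1) := by
        gcongr; exact ha k
    _ = _ := by ring

lemma summable_inverseSeries_bound (hR : 0 ≤ R) (M : ℝ) (n : ℕ) {y : ℝ} (hy : 0 ≤ y)
    (hRy : R * y < 1) :
    Summable fun k => M * y ^ (n + 1) * (((k + n).descFactorial n : ℝ) * (R * y) ^ k) := by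
  apply Summable.mul_left
  apply summable_descFactorial_mul_geometric_of_norm_lt_one
  rwa [Real.norm_of_nonneg (by positivity)]

lemma summable_inverseSeries (hR : 0 ≤ R) (ha : ∀ k, |a k| ≤ M * R ^ k) (n : ℕ) {x : ℝ}
    (hx : R < x) :
    Summable fun k => a k * ((k + n).descFactorial n : ℝ) * x⁻¹ ^ (k + n + 1) := by
  have hx0 : 0 < x := hR.trans_lt hx
  exact .of_norm_bounded (summable_inverseSeries_bound hR M n (inv_pos.2 hx0).le
    (by rw [← div_eq_mul_inv]; exact (div_lt_one hx0).2 hx))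
    fun k => norm_inverseSeries_term_le ha n k (inv_pos.2 hx0).le

lemma hasDerivAt_inverseSeries (hR : 0 ≤ R) (ha : ∀ k, |a k| ≤ M * R ^ k) (n : ℕ) {x : ℝ}
    (hx : R < x) : HasDerivAt (inverseSeries a n) (-inverseSeries a (n + 1) x) x := by
  obtain ⟨ρ, hRρ, hρx⟩ := exists_between hx
  have hρ : 0 < ρ := hR.trans_lt hRρ
  have key := hasDerivAt_tsum_of_isPreconnected (t := Set.Ioi ρ) (y₀ := x) (y := x)
    (g := fun k x => a k * ((k + n).descFactorial n : ℝ) * x⁻¹ ^ (k + n + 1))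
    (g' := fun k x => -(a k * ((k + (n + 1)).descFactorial (n + 1) : ℝ) * x⁻¹ ^ (k + (n + 1) + 1)))
    (summable_inverseSeries_bound hR M (n + 1) (inv_pos.2 hρ).le
      (by rw [← div_eq_mul_inv]; exact (div_lt_one hρ).2 hRρ)) isOpen_Ioi isPreconnected_Ioi
    (fun k y hy => ?_) (fun k y hy => ?_) hρx (summable_inverseSeries hR ha n hx) hρx
  · rw [inverseSeries, ← tsum_neg]
    exact key
  · have hy0 : y ≠ 0 := (hρ.trans hy).ne'
    have := ((hasDerivAt_inv hy0).pow (k + n + 1)).const_mul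
      (a k * ((k + n).descFactorial n : ℝ))
    refine this.congr_deriv ?_
    rw [show k + (n + 1) = k + n + 1 by ring, Nat.succ_descFactorial_succ]
    push_cast
    rw [← inv_pow]
    ring
  · have hy0 : 0 < y := hρ.trans hy
    rw [norm_neg]
    refine (norm_inverseSeries_term_le ha (n + 1) k (inv_pos.2 hy0).le).trans ?_
    have hM : 0 ≤ M := by simpa using (abs_nonneg _).trans (ha 0)
    have : y⁻¹ ≤ ρ⁻¹ := inv_anti₀ hρ (le_of_lt hy)
    gcongr

lemma iteratedDeriv_eq_inverseSeries (hR : 0 ≤ R) (ha : ∀ k, |a k| ≤ M * R ^ k) {f : ℝ → ℝ}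
    (hf : ∀ x, R < x → f x = inverseSeries a 0 x) (n : ℕ) {x : ℝ} (hx : R < x) :
    iteratedDeriv n f x = (-1) ^ n * inverseSeries a n x := by
  induction n generalizing x with
  | zero => simp [hf x hx]
  | succ n ih =>
    rw [iteratedDeriv_succ]
    have h : iteratedDeriv n f =ᶠ[𝓝 x] fun y => (-1) ^ n * inverseSeries a n y := by
      filter_upwards [lt_mem_nhds hx] with y hy using ih hy
    rw [h.deriv_eq, ((hasDerivAt_inverseSeries hR ha n hx).const_mul _).deriv]
    ring

lemma integral_pow_mul_exp_neg_mul_Ioi (m : ℕ) {x : ℝ} (hx : 0 < x) :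
    ∫ t in Ioi (0 : ℝ), t ^ m * Real.exp (-(x * t)) = m.factorial * x⁻¹ ^ (m + 1) := by
  have h := Real.integral_rpow_mul_exp_neg_mul_Ioi (a := m + 1) (r := x) (by positivity) hx
  rw [Real.Gamma_nat_eq_factorial] at h
  rw [mul_comm, ← one_div]
  convert h using 2
  · ext t; simp
  · norm_cast

lemma integrableOn_pow_mul_exp_neg_mul_Ioi (m : ℕ) {x : ℝ} (hx : 0 < x) :
    IntegrableOn (fun t : ℝ => t ^ m * Real.exp (-(x * t))) (Ioi 0) := by
  by_contra h
  have := integral_undef h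
  rw [integral_pow_mul_exp_neg_mul_Ioi m hx] at this
  have : 0 < (m.factorial : ℝ) * x⁻¹ ^ (m + 1) := by positivity
  linarith

lemma summable_mul_pow_div_factorial (ha : ∀ k, |a k| ≤ M * R ^ k) (t : ℝ) :
    Summable fun k => a k * t ^ k / (k.factorial : ℝ) := by
  refine .of_norm_bounded ((Real.summable_pow_div_factorial (R * |t|)).mul_left M) fun k => ?_
  rw [norm_div, norm_mul, norm_pow, Real.norm_eq_abs, Real.norm_eq_abs, Real.norm_natCast,
    mul_pow, ← mul_div_assoc, ← mul_assoc]
  gcongr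
  exact ha k

lemma laplace_pow_mul_series (hR : 0 ≤ R) (ha : ∀ k, |a k| ≤ M * R ^ k) (n : ℕ) {x : ℝ}
    (hx : R < x) :
    IntegrableOn (fun t => t ^ n * Real.exp (-(x * t)) *
      ∑' k, a k * t ^ k / (k.factorial : ℝ)) (Ioi 0) ∧
    ∫ t in Ioi (0 : ℝ), t ^ n * Real.exp (-(x * t)) * ∑' k, a k * t ^ k / (k.factorial : ℝ) =
      inverseSeries a n x := by
  have hx0 : 0 < x := hR.trans_lt hx
  have hfac (k : ℕ) : ((k + n).factorial : ℝ) = (k + n).descFactorial n * k.factorial := by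
    have := Nat.factorial_mul_descFactorial (n := k + n) (k := n) (by omega)
    rw [Nat.add_sub_cancel] at this
    rw [← this]; push_cast; ring
  let F : ℕ → ℝ → ℝ := fun k t => a k / (k.factorial : ℝ) * (t ^ (k + n) * Real.exp (-(x * t)))
  have hFint (k : ℕ) : Integrable (F k) (volume.restrict (Ioi 0)) :=
    (integrableOn_pow_mul_exp_neg_mul_Ioi (k + n) hx0).const_mul _
  have hval (b : ℕ → ℝ) (k : ℕ) :
      ∫ t in Ioi (0 : ℝ), b k / (k.factorial : ℝ) * (t ^ (k + n) * Real.exp (-(x * t))) =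
        b k * ((k + n).descFactorial n : ℝ) * x⁻¹ ^ (k + n + 1) := by
    rw [integral_const_mul, integral_pow_mul_exp_neg_mul_Ioi _ hx0, hfac]
    field_simp
  have hnorm (k : ℕ) : ∫ t in Ioi (0 : ℝ), ‖F k t‖ =
      |a k| * ((k + n).descFactorial n : ℝ) * x⁻¹ ^ (k + n + 1) := by
    rw [← hval fun k => |a k|]
    refine setIntegral_congr_fun measurableSet_Ioi fun t ht => ?_
    have ht : 0 < t := ht
    simp only [F, norm_mul, norm_div, norm_pow, Real.norm_eq_abs, Real.abs_exp, abs_of_pos ht,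
      Nat.abs_cast]
  have hsum : Summable fun k => ∫ t in Ioi (0 : ℝ), ‖F k t‖ := by
    simp_rw [hnorm]
    exact summable_inverseSeries (a := fun k => |a k|) hR (by simpa using ha) n hx
  have hF (t : ℝ) : HasSum (fun k => F k t) (t ^ n * Real.exp (-(x * t)) *
      ∑' k, a k * t ^ k / (k.factorial : ℝ)) := by
    convert! (summable_mul_pow_div_factorial ha t).hasSum.mul_left
      (t ^ n * Real.exp (-(x * t))) using 2 with k
    simp only [F]
    ring
  refine ⟨integrable_of_hasSum_of_summable_integral_norm hFint hsum (.of_forall hF), ?_⟩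
  have := integral_tsum_of_summable_integral_norm hFint hsum
  simp_rw [(hF _).tsum_eq] at this
  rw [← this, inverseSeries]
  exact tsum_congr fun k => hval a k

lemma natCast_choose_div_pow_eq_prod (k : ℕ) {n : ℕ} (hn : 0 < n) :
    ((n + k).choose k : ℝ) / (n : ℝ) ^ k =
      ∏ j ∈ Finset.range k, (1 / ((j : ℝ) + 1) + 1 / (n : ℝ)) := by
  induction k with
  | zero => simp
  | succ k ih =>
    rw [Finset.prod_range_succ, ← ih]
    have h := Nat.add_one_mul_choose_eq (n + k) k
    have h' : ((n : ℝ) + k + 1) * (n + k).choose k = (n + k + 1).choose (k + 1) * (k + 1) := by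
      exact_mod_cast h
    rw [← add_assoc, eq_div_of_mul_eq (by positivity) h'.symm]
    field_simp
    ring

/-- The **Post–Widder inversion formula** for a series `∑ a k * s ^ k / k!`. -/
lemma tendsto_postWidder (hR : 0 ≤ R) (ha : ∀ k, |a k| ≤ M * R ^ k) {s : ℝ} (hs : 0 < s) :
    Tendsto (fun n : ℕ => ((n : ℝ) / s) ^ (n + 1) / (n.factorial : ℝ) *
      inverseSeries a n ((n : ℝ) / s)) atTop (𝓝 (∑' k, a k * s ^ k / (k.factorial : ℝ))) := by
  have hterm : (fun n : ℕ => ((n : ℝ) / s) ^ (n + 1) / (n.factorial : ℝ) *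
      inverseSeries a n ((n : ℝ) / s)) =ᶠ[atTop] fun n : ℕ =>
      ∑' k, a k * s ^ k * ∏ j ∈ Finset.range k, (1 / ((j : ℝ) + 1) + 1 / (n : ℝ)) := by
    filter_upwards [eventually_gt_atTop 0] with n hn
    rw [inverseSeries, ← tsum_mul_left]
    refine tsum_congr fun k => ?_
    have hn' : (n : ℝ) ≠ 0 := by positivity
    have hc : (k + n).choose n = (n + k).choose k := by rw [add_comm, Nat.choose_symm_add]
    rw [← natCast_choose_div_pow_eq_prod k hn, Nat.descFactorial_eq_factorial_mul_choose, hc]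
    have hp : ((n : ℝ) / s) ^ (n + 1) * ((n : ℝ) / s)⁻¹ ^ (k + n + 1) = s ^ k / (n : ℝ) ^ k := by
      rw [add_assoc, pow_add _ k, inv_pow _ (n + 1), inv_div, div_pow s]
      field_simp
    push_cast
    calc _ = a k * ((n + k).choose k : ℝ) * (((n : ℝ) / s) ^ (n + 1) *
          ((n : ℝ) / s)⁻¹ ^ (k + n + 1)) := by field_simp
      _ = _ := by rw [hp]; ring
  rw [tendsto_congr' hterm]
  obtain ⟨N, hN⟩ := exists_nat_gt (R * s)
  have hN0 : 0 < N := by exact_mod_cast (by positivity : 0 ≤ R * s).trans_lt hN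
  have hM : 0 ≤ M := by simpa using (abs_nonneg _).trans (ha 0)
  refine tendsto_tsum_of_dominated_convergence
    (bound := fun k => M * (((k + N).choose N : ℝ) * (R * s / N) ^ k)) ?_ (fun k => ?_) ?_
  · apply Summable.mul_left
    apply summable_choose_mul_geometric_of_norm_lt_one
    rw [Real.norm_of_nonneg (by positivity)]
    exact (div_lt_one (by positivity)).2 hN
  · rw [div_eq_mul_inv]
    refine Tendsto.const_mul _ ?_
    have : ((k.factorial : ℝ))⁻¹ = ∏ j ∈ Finset.range k, (1 / ((j : ℝ) + 1) + 0) := by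
      rw [← Finset.prod_range_add_one_eq_factorial]
      push_cast
      simp
    rw [this]
    exact tendsto_finsetProd _ fun j _ => tendsto_const_nhds.add tendsto_one_div_atTop_nhds_zero_nat
  · filter_upwards [eventually_ge_atTop N] with n hn k
    have hprod : 0 ≤ ∏ j ∈ Finset.range k, (1 / ((j : ℝ) + 1) + 1 / (n : ℝ)) :=
      Finset.prod_nonneg fun j _ => by positivity
    rw [norm_mul, norm_mul, Real.norm_of_nonneg hprod, Real.norm_eq_abs,
      Real.norm_of_nonneg (pow_nonneg hs.le k)]
    calc _ ≤ M * R ^ k * s ^ k *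
          ∏ j ∈ Finset.range k, (1 / ((j : ℝ) + 1) + 1 / (N : ℝ)) := by
          gcongr
          exact ha k
      _ = _ := by
          rw [← natCast_choose_div_pow_eq_prod k hN0, ← Nat.choose_symm_add, add_comm k N]
          ring

end Growth

lemma hasSum_taylor_of_differentiableOn_complex {f : ℝ → ℝ} {F : ℂ → ℂ}
    (hF : DifferentiableOn ℂ F {z | 0 < z.re}) (hfF : ∀ x : ℝ, 0 < x → F x = f x)
    {x₀ x : ℝ} (hx : 0 < x) (hxx₀ : x < x₀) :
    HasSum (fun n : ℕ => (n.factorial : ℝ)⁻¹ * ((x - x₀) ^ n * iteratedDeriv n f x₀)) (f x) := by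
  have hopen : IsOpen {z : ℂ | 0 < z.re} := isOpen_lt continuous_const Complex.continuous_re
  have hder (n : ℕ) : ∀ y : ℝ, 0 < y → iteratedDeriv n f y = (iteratedDeriv n F y).re := by
    induction n with
    | zero => intro y hy; simp [hfF y hy]
    | succ n ih =>
      intro y hy
      have hev : iteratedDeriv n f =ᶠ[𝓝 y] fun u : ℝ => (iteratedDeriv n F u).re := by
        filter_upwards [lt_mem_nhds hy] with u hu using ih u hu
      have hdiff : DifferentiableAt ℂ (iteratedDeriv n F) (y : ℂ) := by
        have hmem : {z : ℂ | 0 < z.re} ∈ 𝓝 (y : ℂ) := hopen.mem_nhds (by simpa using hy)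
        have hA : AnalyticAt ℂ F (y : ℂ) := hF.analyticAt hmem
        rw [iteratedDeriv_eq_iterate]
        exact (hA.iterated_deriv n).differentiableAt
      rw [iteratedDeriv_succ, iteratedDeriv_succ, hev.deriv_eq,
        hdiff.hasDerivAt.real_of_complex.deriv]
  have hball : Metric.ball (x₀ : ℂ) x₀ ⊆ {z | 0 < z.re} := by
    intro z hz
    rw [Metric.mem_ball, dist_eq_norm] at hz
    have := (Complex.abs_re_le_norm (z - x₀)).trans_lt hz
    rw [Complex.sub_re, Complex.ofReal_re, abs_lt] at this
    simp only [mem_ofPred_eq]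
    linarith
  have hmem : (x : ℂ) ∈ Metric.ball (x₀ : ℂ) x₀ := by
    rw [Metric.mem_ball, dist_eq_norm, ← Complex.ofReal_sub, Complex.norm_real, Real.norm_eq_abs,
      abs_lt]
    constructor <;> linarith
  have h := Complex.hasSum_re (Complex.hasSum_taylorSeries_on_ball (hF.mono hball) hmem)
  rw [hfF x hx, Complex.ofReal_re] at h
  convert! h using 2 with n
  rw [hder n x₀ (hx.trans hxx₀), smul_eq_mul, smul_eq_mul]
  have h1 : ((n.factorial : ℂ))⁻¹ * (((x : ℂ) - x₀) ^ n * iteratedDeriv n F x₀) =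
      (((n.factorial : ℝ)⁻¹ * (x - x₀) ^ n : ℝ) : ℂ) * iteratedDeriv n F x₀ := by
    push_cast; ring
  rw [h1, Complex.re_ofReal_mul]
  ring

/-- A Landau-type theorem: the Laplace integral of a nonnegative function represents `f` as far
to the left of `x₀` as the Taylor series of `f` at `x₀` does. -/
lemma laplace_extend_of_nonneg {f φ : ℝ → ℝ} {x x₀ : ℝ} (hxx₀ : x < x₀)
    (hφ : ∀ t, 0 < t → 0 ≤ φ t)
    (htaylor : HasSum (fun n : ℕ => (n.factorial : ℝ)⁻¹ * ((x - x₀) ^ n * iteratedDeriv n f x₀))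
      (f x))
    (hint : ∀ n : ℕ, IntegrableOn (fun t => t ^ n * Real.exp (-(x₀ * t)) * φ t) (Ioi 0))
    (hval : ∀ n : ℕ, iteratedDeriv n f x₀ =
      (-1) ^ n * ∫ t in Ioi (0 : ℝ), t ^ n * Real.exp (-(x₀ * t)) * φ t) :
    IntegrableOn (fun t => Real.exp (-(x * t)) * φ t) (Ioi 0) ∧
      ∫ t in Ioi (0 : ℝ), Real.exp (-(x * t)) * φ t = f x := by
  let F : ℕ → ℝ → ℝ := fun n t =>
    (n.factorial : ℝ)⁻¹ * (x₀ - x) ^ n * (t ^ n * Real.exp (-(x₀ * t)) * φ t)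
  have hd : 0 < x₀ - x := sub_pos.2 hxx₀
  have hFint (n : ℕ) : Integrable (F n) (volume.restrict (Ioi 0)) := (hint n).const_mul _
  have hFval (n : ℕ) : ∫ t in Ioi (0 : ℝ), F n t =
      (n.factorial : ℝ)⁻¹ * ((x - x₀) ^ n * iteratedDeriv n f x₀) := by
    simp only [F]
    rw [integral_const_mul, hval, ← neg_sub x₀ x, neg_pow (x₀ - x), mul_assoc]
    have : ((-1 : ℝ) ^ n) * (-1) ^ n = 1 := by rw [← mul_pow]; simp
    linear_combination (-(n.factorial : ℝ)⁻¹ * (x₀ - x) ^ n *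
      ∫ t in Ioi (0 : ℝ), t ^ n * Real.exp (-(x₀ * t)) * φ t) * this
  have hFnorm (n : ℕ) : ∫ t in Ioi (0 : ℝ), ‖F n t‖ = ∫ t in Ioi (0 : ℝ), F n t := by
    refine setIntegral_congr_fun measurableSet_Ioi fun t ht => Real.norm_of_nonneg ?_
    have ht : 0 < t := ht
    have := hφ t ht
    positivity
  have hsum : Summable fun n => ∫ t in Ioi (0 : ℝ), ‖F n t‖ := by
    simp_rw [hFnorm, hFval]
    exact htaylor.summable
  have hF (t : ℝ) : HasSum (fun n => F n t) (Real.exp (-(x * t)) * φ t) := by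
    have h := (NormedSpace.expSeries_div_hasSum_exp ((x₀ - x) * t)).mul_right
      (Real.exp (-(x₀ * t)) * φ t)
    rw [← Real.exp_eq_exp_ℝ, ← mul_assoc, ← Real.exp_add] at h
    convert! h using 2 with n
    · simp only [F, mul_pow]
      ring
    · ring_nf
  refine ⟨integrable_of_hasSum_of_summable_integral_norm hFint hsum (.of_forall hF), ?_⟩
  have := integral_tsum_of_summable_integral_norm hFint hsum
  simp_rw [(hF _).tsum_eq, hFval, htaylor.tsum_eq] at this
  exact this.symm

lemma completelyMonotonicOn_of_laplace {f φ : ℝ → ℝ} (hφm : Measurable φ)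
    (hφ : ∀ t, 0 < t → 0 ≤ φ t)
    (hint : ∀ x, 0 < x → IntegrableOn (fun t => Real.exp (-(x * t)) * φ t) (Ioi 0))
    (hval : ∀ x, 0 < x → ∫ t in Ioi (0 : ℝ), Real.exp (-(x * t)) * φ t = f x) :
    CompletelyMonotonicOn f := by
  set μ : Measure ℝ := (volume.restrict (Ioi 0)).withDensity (fun t => ((φ t).toNNReal : ENNReal))
    with hμ
  have hcoe (x : ℝ) : (fun t => (φ t).toNNReal • Real.exp (x * -t))
      =ᵐ[volume.restrict (Ioi 0)] fun t => Real.exp (-(x * t)) * φ t := by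
    filter_upwards [ae_restrict_mem measurableSet_Ioi] with t ht
    rw [NNReal.smul_def, Real.coe_toNNReal _ (hφ t ht), smul_eq_mul, mul_comm, mul_neg]
  have hset : Ioi 0 ⊆ interior (ProbabilityTheory.integrableExpSet (fun t => -t) μ) := by
    refine interior_maximal (fun x hx => ?_) isOpen_Ioi
    rw [ProbabilityTheory.integrableExpSet, mem_ofPred_eq, hμ,
      integrable_withDensity_iff_integrable_smul hφm.real_toNNReal]
    exact (hint x hx).congr (hcoe x).symm
  have hmgf : EqOn f (ProbabilityTheory.mgf (fun t => -t) μ) (Ioi 0) := by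
    intro x hx
    rw [← hval x hx, ProbabilityTheory.mgf, hμ,
      integral_withDensity_eq_integral_smul hφm.real_toNNReal]
    exact (integral_congr_ae (hcoe x)).symm
  refine ⟨?_, fun n x hx => ?_⟩
  · exact ((ProbabilityTheory.analyticOnNhd_mgf.mono hset).contDiffOn
      (uniqueDiffOn_Ioi 0)).congr hmgf
  · rw [iteratedDerivWithin_congr hmgf hx, iteratedDerivWithin_of_isOpen isOpen_Ioi hx,
      ProbabilityTheory.iteratedDeriv_mgf (hset hx), ← integral_const_mul]
    refine integral_nonneg_of_ae ?_
    filter_upwards [(withDensity_absolutelyContinuous _ _).ae_le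
      (ae_restrict_mem measurableSet_Ioi)] with t ht
    have ht : 0 < t := ht
    rw [← mul_assoc, ← mul_pow]
    simp only [Pi.zero_apply, neg_mul_neg, one_mul]
    positivity

lemma integral_of_laplace {f φ : ℝ → ℝ} {c : ℝ} (hφm : Measurable φ) (hφ : ∀ t, 0 < t → 0 ≤ φ t)
    (hint : ∀ x, 0 < x → IntegrableOn (fun t => Real.exp (-(x * t)) * φ t) (Ioi 0))
    (hval : ∀ x, 0 < x → ∫ t in Ioi (0 : ℝ), Real.exp (-(x * t)) * φ t = f x)
    (hlim : Tendsto (fun n : ℕ => f (1 / ((n : ℝ) + 1))) atTop (𝓝 c)) :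
    IntegrableOn φ (Ioi 0) ∧ ∫ t in Ioi (0 : ℝ), φ t = c := by
  have hpos (n : ℕ) : (0 : ℝ) < 1 / ((n : ℝ) + 1) := by positivity
  have hφ' : 0 ≤ᵐ[volume.restrict (Ioi 0)] φ := by
    filter_upwards [ae_restrict_mem measurableSet_Ioi] with t ht using hφ t ht
  have hg' (n : ℕ) : 0 ≤ᵐ[volume.restrict (Ioi 0)]
      fun t => Real.exp (-(1 / ((n : ℝ) + 1) * t)) * φ t := by
    filter_upwards [hφ'] with t ht using mul_nonneg (Real.exp_pos _).le ht
  have hnonneg (n : ℕ) : 0 ≤ f (1 / ((n : ℝ) + 1)) := by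
    rw [← hval _ (hpos n)]
    exact integral_nonneg_of_ae (hg' n)
  have hc : 0 ≤ c := ge_of_tendsto' hlim hnonneg
  have h1 : Tendsto (fun n : ℕ => ∫⁻ t in Ioi (0 : ℝ),
      ENNReal.ofReal (Real.exp (-(1 / ((n : ℝ) + 1) * t)) * φ t)) atTop
      (𝓝 (∫⁻ t in Ioi (0 : ℝ), ENNReal.ofReal (φ t))) := by
    refine lintegral_tendsto_of_tendsto_of_monotone (fun n => by fun_prop) ?_ ?_
    · filter_upwards [ae_restrict_mem measurableSet_Ioi] with t ht m n hmn
      have ht : 0 < t := ht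
      have := hφ t ht
      beta_reduce
      gcongr
    · refine .of_forall fun t => ENNReal.tendsto_ofReal ?_
      have := ((tendsto_one_div_add_atTop_nhds_zero_nat (𝕜 := ℝ)).mul_const t).neg.rexp.mul_const
        (φ t)
      simpa using this
  have h2 (n : ℕ) : ∫⁻ t in Ioi (0 : ℝ),
      ENNReal.ofReal (Real.exp (-(1 / ((n : ℝ) + 1) * t)) * φ t) =
      ENNReal.ofReal (f (1 / ((n : ℝ) + 1))) := by
    rw [← hval _ (hpos n), ofReal_integral_eq_lintegral_ofReal (hint _ (hpos n)) (hg' n)]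
  simp_rw [h2] at h1
  have h3 := tendsto_nhds_unique h1 (ENNReal.tendsto_ofReal hlim)
  refine ⟨⟨hφm.aestronglyMeasurable, ?_⟩, ?_⟩
  · rw [hasFiniteIntegral_iff_ofReal hφ', h3]
    exact ENNReal.ofReal_lt_top
  · rw [integral_eq_lintegral_of_nonneg_ae hφ' hφm.aestronglyMeasurable, h3, ENNReal.toReal_ofReal hc]

section BmpP

variable {α : ℝ}

lemma bmpP_zero (α : ℝ) : bmpP α 0 = 1 := by rw [bmpP]

lemma succ_mul_bmpP_succ (α : ℝ) (n : ℕ) : ((n : ℝ) + 1) * bmpP α (n + 1) =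
    α * ∑ k ∈ Finset.range (n + 1), ((k + 1 : ℝ) / (k + 2)) * bmpP α (n - k) := by
  rw [bmpP]
  field_simp

lemma bmpP_nonneg (hα : 0 ≤ α) (n : ℕ) : 0 ≤ bmpP α n := by
  induction n using Nat.strong_induction_on with
  | _ n ih =>
    cases n with
    | zero => rw [bmpP_zero]; exact zero_le_one
    | succ n =>
      rw [bmpP]
      refine mul_nonneg (by positivity) (Finset.sum_nonneg fun k _ => ?_)
      exact mul_nonneg (by positivity) (ih _ (by omega))

lemma bmpP_le (hα : 0 ≤ α) (n : ℕ) : bmpP α n ≤ (1 + α) ^ n := by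
  induction n using Nat.strong_induction_on with
  | _ n ih =>
    cases n with
    | zero => simp [bmpP_zero]
    | succ n =>
      have hsum : ∑ k ∈ Finset.range (n + 1), ((k + 1 : ℝ) / (k + 2)) * bmpP α (n - k) ≤
          (n + 1) * (1 + α) ^ n := by
        calc _ ≤ ∑ k ∈ Finset.range (n + 1), (1 + α) ^ n := by
              refine Finset.sum_le_sum fun k _ => ?_
              have h1 : ((k + 1 : ℝ) / (k + 2)) ≤ 1 := by
                rw [div_le_one (by positivity)]; linarith
              calc _ ≤ 1 * bmpP α (n - k) :=
                    mul_le_mul_of_nonneg_right h1 (bmpP_nonneg hα _)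
                _ ≤ (1 + α) ^ (n - k) := by rw [one_mul]; exact ih _ (by omega)
                _ ≤ _ := pow_le_pow_right₀ (by linarith) (by omega)
          _ = _ := by simp
      rw [bmpP]
      calc _ ≤ α / (n + 1) * ((n + 1) * (1 + α) ^ n) := by gcongr
        _ = α * (1 + α) ^ n := by field_simp
        _ ≤ _ := by rw [pow_succ]; nlinarith [pow_nonneg (by linarith : 0 ≤ 1 + α) n]

/-- The coefficients of the expansion of `(1 + 1 / x) ^ (α * x)` in powers of `1 / x`, up to the
factor `exp α`. -/
noncomputable def bmpSignedCoeff (α : ℝ) (k : ℕ) : ℝ := (-1) ^ k * bmpP α k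

/-- The coefficients of the expansion of `exp α - (1 + 1 / x) ^ (α * x)` in powers of `1 / x`. -/
noncomputable def bmpCoeff (α : ℝ) (k : ℕ) : ℝ := Real.exp α * ((-1) ^ k * bmpP α (k + 1))

lemma abs_bmpSignedCoeff_le (hα : 0 ≤ α) (k : ℕ) : |bmpSignedCoeff α k| ≤ 1 * (1 + α) ^ k := by
  rw [bmpSignedCoeff, abs_mul, abs_pow, abs_neg, abs_one, one_pow, one_mul, one_mul,
    abs_of_nonneg (bmpP_nonneg hα k)]
  exact bmpP_le hα k

lemma abs_bmpCoeff_le (hα : 0 ≤ α) (k : ℕ) :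
    |bmpCoeff α k| ≤ (Real.exp α * (1 + α)) * (1 + α) ^ k := by
  rw [bmpCoeff, abs_mul, abs_mul, abs_pow, abs_neg, abs_one, one_pow, one_mul, Real.abs_exp,
    abs_of_nonneg (bmpP_nonneg hα _), mul_assoc, ← pow_succ']
  gcongr
  exact bmpP_le hα _

lemma bmpPhiR_eq_tsum (α s : ℝ) :
    bmpPhiR α s = ∑' k, bmpCoeff α k * s ^ k / (k.factorial : ℝ) := by
  rw [bmpPhiR, ← tsum_mul_left]
  refine tsum_congr fun k => ?_
  rw [bmpCoeff]
  ring

lemma measurable_bmpPhiR (hα : 0 ≤ α) : Measurable (bmpPhiR α) := by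
  refine measurable_of_tendsto_metrizable (f := fun (N : ℕ) s =>
    ∑ k ∈ Finset.range N, bmpCoeff α k * s ^ k / (k.factorial : ℝ)) (fun N => by fun_prop) ?_
  rw [tendsto_pi_nhds]
  intro s
  rw [bmpPhiR_eq_tsum]
  exact (summable_mul_pow_div_factorial (abs_bmpCoeff_le hα) s).hasSum.tendsto_sum_nat

lemma hasSum_succ_div_mul_pow {x : ℝ} (hx : 1 < x) :
    HasSum (fun k : ℕ => ((k + 1 : ℝ) / (k + 2)) * (-x⁻¹) ^ k)
      (x ^ 2 * (Real.log (1 + 1 / x) - 1 / (x + 1))) := by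
  have hx0 : 0 < x := by linarith
  have hz : |(-x⁻¹)| < 1 := by
    rw [abs_neg, abs_of_pos (by positivity)]
    exact inv_lt_one_of_one_lt₀ hx
  have h1 := ((hasSum_geometric_of_abs_lt_one hz).mul_left (-x⁻¹)).sub
    (Real.hasSum_pow_div_log_of_abs_lt_one hz)
  have h2 := ((hasSum_nat_add_iff' 1).2 h1).mul_left (x ^ 2)
  convert! h2 using 2 with k
  · have hxz : x * -x⁻¹ = -1 := by rw [mul_neg, mul_inv_cancel₀ hx0.ne']
    generalize -x⁻¹ = z at hxz ⊢
    have h : x ^ 2 * (z * z ^ (k + 1) - z ^ (k + 1 + 1) / (((k + 1 : ℕ) : ℝ) + 1)) =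
        (x * z) ^ 2 * z ^ k * (1 - 1 / ((k : ℝ) + 2)) := by
      push_cast
      ring
    rw [h, hxz]
    field_simp
    ring
  · have h : -x⁻¹ * (1 + 1 / x)⁻¹ = -(1 / (x + 1)) := by field_simp
    rw [show 1 - -x⁻¹ = 1 + 1 / x by ring, h]
    simp
    ring

lemma hasDerivAt_mul_log_one_add_inv {x : ℝ} (hx : 0 < x) :
    HasDerivAt (fun x : ℝ => x * Real.log (1 + 1 / x)) (Real.log (1 + 1 / x) - 1 / (x + 1)) x := by
  have h0 : (1 + 1 / x) ≠ 0 := by positivity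
  have h : HasDerivAt (fun x : ℝ => 1 + 1 / x) (-(x ^ 2)⁻¹) x := by
    simpa using (hasDerivAt_inv hx.ne').const_add 1
  refine ((hasDerivAt_id x).mul (h.log h0)).congr_deriv ?_
  simp only [id]
  field_simp
  ring

lemma mul_inverseSeries_zero (a : ℕ → ℝ) {x : ℝ} (hx : 0 < x) :
    x * inverseSeries a 0 x = ∑' k, a k * x⁻¹ ^ k := by
  rw [inverseSeries, ← tsum_mul_left]
  refine tsum_congr fun k => ?_
  rw [Nat.add_zero, Nat.descFactorial_zero, pow_succ]
  field_simp
  simp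

lemma inverseSeries_zero_sub_mul_inverseSeries_one (hα : 0 ≤ α) {x : ℝ} (hx : 1 + α < x) :
    inverseSeries (bmpSignedCoeff α) 0 x - x * inverseSeries (bmpSignedCoeff α) 1 x =
      x * inverseSeries (bmpSignedCoeff α) 0 x *
        (α * (Real.log (1 + 1 / x) - 1 / (x + 1))) := by
  have hR : 0 ≤ 1 + α := by linarith
  have hx0 : 0 < x := by linarith
  have hb := abs_bmpSignedCoeff_le hα
  have hpow (k : ℕ) : bmpSignedCoeff α k * x⁻¹ ^ k = bmpP α k * (-x⁻¹) ^ k := by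
    rw [bmpSignedCoeff, neg_pow]; ring
  have h0 := summable_inverseSeries hR hb 0 hx
  have h1 := summable_inverseSeries hR hb 1 hx
  have hsub := (h0.hasSum.sub (h1.hasSum.mul_left x))
  rw [← hasSum_nat_add_iff' 1] at hsub
  have hleft : inverseSeries (bmpSignedCoeff α) 0 x - x * inverseSeries (bmpSignedCoeff α) 1 x =
      ∑' k : ℕ, (x ^ 2)⁻¹ * (((k : ℝ) + 1) * bmpP α (k + 1) * (-x⁻¹) ^ k) := by
    rw [eq_comm]
    convert! hsub.tsum_eq using 1
    · refine tsum_congr fun k => ?_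
      rw [bmpSignedCoeff, Nat.descFactorial_one, Nat.descFactorial_zero, neg_pow x⁻¹]
      push_cast
      rw [← inv_pow]
      have hxy : x * x⁻¹ = 1 := mul_inv_cancel₀ hx0.ne'
      generalize x⁻¹ = y at hxy ⊢
      linear_combination (-((k : ℝ) + 2) * (-1) ^ k * bmpP α (k + 1) * y ^ (k + 2)) * hxy
    · have h : x * (bmpSignedCoeff α 0 * (x ^ 2)⁻¹) = bmpSignedCoeff α 0 * x⁻¹ := by field_simp
      simp [inverseSeries, h]
  have hcoef : Summable fun k : ℕ => ‖((k + 1 : ℝ) / (k + 2)) * (-x⁻¹) ^ k‖ :=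
    (hasSum_succ_div_mul_pow (by linarith)).summable.norm
  have hP : Summable fun k : ℕ => ‖bmpP α k * (-x⁻¹) ^ k‖ := by
    simp_rw [← hpow]
    refine Summable.norm ?_
    convert! h0.mul_left x using 2 with k
    rw [Nat.add_zero, Nat.descFactorial_zero, pow_succ]
    field_simp
    simp
  rw [hleft, mul_inverseSeries_zero _ hx0, tsum_congr hpow, tsum_mul_left]
  have hlog : Real.log (1 + 1 / x) - 1 / (x + 1) =
      (x ^ 2)⁻¹ * ∑' k : ℕ, ((k + 1 : ℝ) / (k + 2)) * (-x⁻¹) ^ k := by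
    rw [(hasSum_succ_div_mul_pow (by linarith)).tsum_eq]
    field_simp
  have hprod := tsum_mul_tsum_eq_tsum_sum_range_of_summable_norm hcoef hP
  calc _ = (x ^ 2)⁻¹ * (α * ∑' n : ℕ, ∑ k ∈ Finset.range (n + 1),
        ((k + 1 : ℝ) / (k + 2)) * (-x⁻¹) ^ k * (bmpP α (n - k) * (-x⁻¹) ^ (n - k))) := by
        rw [← tsum_mul_left (a := α)]
        congr 1
        refine tsum_congr fun n => ?_
        rw [succ_mul_bmpP_succ, mul_assoc, Finset.sum_mul]
        congr 1
        refine Finset.sum_congr rfl fun k hk => ?_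
        rw [show n = k + (n - k) by have := Finset.mem_range.1 hk; omega, pow_add,
          Nat.add_sub_cancel_left]
        ring
    _ = _ := by rw [← hprod, hlog]; ring

lemma tendsto_mul_inverseSeries_zero (hα : 0 ≤ α) :
    Tendsto (fun x => x * inverseSeries (bmpSignedCoeff α) 0 x) atTop (𝓝 1) := by
  have h : Tendsto (fun x : ℝ => ∑' k, bmpSignedCoeff α k * x⁻¹ ^ k) atTop
      (𝓝 (∑' k, if k = 0 then (1 : ℝ) else 0)) := by
    refine tendsto_tsum_of_dominated_convergence (bound := fun k => (1 / 2 : ℝ) ^ k)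
      summable_geometric_two (fun k => ?_) ?_
    · rcases eq_or_ne k 0 with rfl | hk
      · simp [bmpSignedCoeff, bmpP_zero]
      · simpa [hk] using (tendsto_inv_atTop_zero.pow k).const_mul (bmpSignedCoeff α k)
    · filter_upwards [eventually_ge_atTop (2 * (1 + α))] with x hx k
      have hx0 : 0 < x := by linarith
      rw [norm_mul, Real.norm_eq_abs, Real.norm_of_nonneg (by positivity)]
      calc _ ≤ 1 * (1 + α) ^ k * x⁻¹ ^ k := by
            gcongr; exact abs_bmpSignedCoeff_le hα k
        _ = ((1 + α) / x) ^ k := by rw [one_mul, ← mul_pow, div_eq_mul_inv]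
        _ ≤ _ := by
            refine pow_le_pow_left₀ (by positivity) ?_ k
            rw [div_le_div_iff₀ hx0 two_pos]
            linarith
  rw [tsum_ite_eq] at h
  refine h.congr' ?_
  filter_upwards [eventually_gt_atTop 0] with x hx using (mul_inverseSeries_zero _ hx).symm

lemma exp_mul_mul_inverseSeries (hα : 0 ≤ α) {x : ℝ} (hx : 1 + α < x) :
    Real.exp α * (x * inverseSeries (bmpSignedCoeff α) 0 x) = (1 + 1 / x) ^ (α * x) := by
  have hR : 0 ≤ 1 + α := by linarith
  have hx0 : 0 < x := by linarith
  set W : ℝ → ℝ := fun x => x * inverseSeries (bmpSignedCoeff α) 0 x *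
    Real.exp (-(α * (x * Real.log (1 + 1 / x)))) with hW
  have hder (y : ℝ) (hy : 1 + α < y) : HasDerivAt W 0 y := by
    have h := ((hasDerivAt_id y).mul (hasDerivAt_inverseSeries hR (abs_bmpSignedCoeff_le hα) 0 hy)
      ).mul ((hasDerivAt_mul_log_one_add_inv (by linarith : 0 < y)).const_mul α).neg.exp
    refine h.congr_deriv ?_
    have key := inverseSeries_zero_sub_mul_inverseSeries_one hα hy
    simp only [id, Pi.mul_apply]
    linear_combination Real.exp (-(α * (y * Real.log (1 + 1 / y)))) * key
  have hconst (y : ℝ) (hy : 1 + α < y) : W y = W x :=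
    isOpen_Ioi.is_const_of_deriv_eq_zero isPreconnected_Ioi
      (fun u hu => (hder u hu).differentiableAt.differentiableWithinAt)
      (fun u hu => (hder u hu).deriv) hy hx
  have hlim : Tendsto W atTop (𝓝 (1 * Real.exp (-(α * 1)))) :=
    (tendsto_mul_inverseSeries_zero hα).mul
      ((Real.tendsto_mul_log_one_add_div_atTop 1).const_mul α).neg.rexp
  have hWx : W x = 1 * Real.exp (-(α * 1)) := by
    refine tendsto_nhds_unique (tendsto_const_nhds.congr' ?_) hlim
    filter_upwards [eventually_gt_atTop (1 + α)] with y hy using (hconst y hy).symm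
  rw [Real.rpow_def_of_pos (by positivity)]
  simp only [hW] at hWx
  rw [mul_one, one_mul, Real.exp_neg, Real.exp_neg, ← div_eq_mul_inv, div_eq_iff
    (Real.exp_pos _).ne'] at hWx
  rw [hWx, ← mul_assoc, mul_inv_cancel₀ (Real.exp_pos _).ne', one_mul]
  ring_nf

lemma exp_sub_rpow_eq_inverseSeries (hα : 0 ≤ α) {x : ℝ} (hx : 1 + α < x) :
    Real.exp α - (1 + 1 / x) ^ (α * x) = inverseSeries (bmpCoeff α) 0 x := by
  have hR : 0 ≤ 1 + α := by linarith
  have hx0 : 0 < x := by linarith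
  have h0 := (summable_inverseSeries hR (abs_bmpSignedCoeff_le hα) 0 hx).mul_left x
  rw [← exp_mul_mul_inverseSeries hα hx, inverseSeries, ← tsum_mul_left, h0.tsum_eq_zero_add,
    inverseSeries]
  have h1 : (∑' k : ℕ, bmpCoeff α k * ((k + 0).descFactorial 0 : ℝ) * x⁻¹ ^ (k + 0 + 1)) =
      -Real.exp α * ∑' k : ℕ, x * (bmpSignedCoeff α (k + 1) *
        ((k + 1 + 0).descFactorial 0 : ℝ) * x⁻¹ ^ (k + 1 + 0 + 1)) := by
    rw [← tsum_mul_left]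
    refine tsum_congr fun k => ?_
    rw [bmpCoeff, bmpSignedCoeff]
    simp only [Nat.descFactorial_zero]
    push_cast
    have hxy : x * x⁻¹ = 1 := mul_inv_cancel₀ hx0.ne'
    generalize x⁻¹ = y at hxy ⊢
    linear_combination (-Real.exp α * (-1) ^ k * bmpP α (k + 1) * y ^ (k + 1)) * hxy
  rw [h1]
  simp [bmpSignedCoeff, bmpP_zero, hx0.ne']
  ring

end BmpP

lemma differentiableOn_exp_sub_exp_mul_log (α : ℝ) :
    DifferentiableOn ℂ (fun z : ℂ => Complex.exp α -
      Complex.exp (α * (z * Complex.log (1 + 1 / z)))) {z | 0 < z.re} := by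
  intro z hz
  have hz' : 0 < z.re := hz
  have hz0 : z ≠ 0 := by rintro rfl; simp at hz'
  have hslit : 1 + 1 / z ∈ Complex.slitPlane := by
    left
    rw [Complex.add_re, Complex.one_re, one_div, Complex.inv_re]
    have := Complex.normSq_pos.2 hz0
    positivity
  have h : DifferentiableAt ℂ (fun z : ℂ => 1 + 1 / z) z := by fun_prop (disch := assumption)
  exact ((((differentiableAt_id.mul (h.clog hslit)).const_mul _).cexp).const_sub _
    ).differentiableWithinAt

lemma exp_sub_exp_mul_log_ofReal (α : ℝ) {x : ℝ} (hx : 0 < x) :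
    Complex.exp α - Complex.exp (α * ((x : ℂ) * Complex.log (1 + 1 / (x : ℂ)))) =
      ((Real.exp α - (1 + 1 / x) ^ (α * x) : ℝ) : ℂ) := by
  have h : (0 : ℝ) < 1 + 1 / x := by positivity
  rw [Real.rpow_def_of_pos h]
  push_cast [Complex.ofReal_log h.le]
  ring_nf

lemma tendsto_exp_sub_rpow (α : ℝ) :
    Tendsto (fun n : ℕ => Real.exp α - (1 + 1 / (1 / ((n : ℝ) + 1))) ^ (α * (1 / ((n : ℝ) + 1))))
      atTop (𝓝 (Real.exp α - 1)) := by
  have h := (tendsto_rpow_div_mul_add α 1 (-1) zero_ne_one).comp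
    (tendsto_atTop_add_const_right atTop (2 : ℝ) tendsto_natCast_atTop_atTop)
  refine (h.congr fun n => ?_).const_sub _
  simp only [Function.comp_apply, one_div_one_div]
  congr 1 <;> ring

lemma laplace_bmpPhiR {α : ℝ} (hα : 0 ≤ α) (hφ : ∀ s, 0 ≤ s → 0 ≤ bmpPhiR α s) {x : ℝ}
    (hx : 0 < x) :
    IntegrableOn (fun t => Real.exp (-(x * t)) * bmpPhiR α t) (Ioi 0) ∧
      ∫ t in Ioi (0 : ℝ), Real.exp (-(x * t)) * bmpPhiR α t =
        Real.exp α - (1 + 1 / x) ^ (α * x) := by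
  have hR : 0 ≤ 1 + α := by linarith
  have hx₀ : 1 + α < x + (1 + α) := by linarith
  have hL (n : ℕ) := laplace_pow_mul_series hR (abs_bmpCoeff_le hα) n hx₀
  simp_rw [← bmpPhiR_eq_tsum] at hL
  refine laplace_extend_of_nonneg (x₀ := x + (1 + α))
    (f := fun x => Real.exp α - (1 + 1 / x) ^ (α * x)) (by linarith) (fun t ht => hφ t ht.le)
    (hasSum_taylor_of_differentiableOn_complex (differentiableOn_exp_sub_exp_mul_log α)
      (fun y hy => exp_sub_exp_mul_log_ofReal α hy) hx (by linarith)) (fun n => (hL n).1)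
    fun n => ?_
  rw [(hL n).2]
  exact iteratedDeriv_eq_inverseSeries hR (abs_bmpCoeff_le hα)
    (fun y hy => exp_sub_rpow_eq_inverseSeries hα hy) n hx₀

lemma bmpPhiR_nonneg_of_completelyMonotonicOn {α : ℝ} (hα : 0 ≤ α)
    (hf : CompletelyMonotonicOn (fun x : ℝ => Real.exp α - (1 + 1 / x) ^ (α * x))) {s : ℝ}
    (hs : 0 ≤ s) : 0 ≤ bmpPhiR α s := by
  have hR : 0 ≤ 1 + α := by linarith
  rcases hs.eq_or_lt with rfl | hs
  · rw [bmpPhiR_eq_tsum, tsum_eq_single 0 fun k hk => by simp [hk], bmpCoeff]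
    have := bmpP_nonneg hα 1
    simp only [pow_zero, one_mul, mul_one, Nat.factorial_zero, Nat.cast_one, div_one, zero_add]
    positivity
  · rw [bmpPhiR_eq_tsum]
    refine ge_of_tendsto (tendsto_postWidder hR (abs_bmpCoeff_le hα) hs) ?_
    have hev : ∀ᶠ n : ℕ in atTop, 1 + α < (n : ℝ) / s :=
      (tendsto_natCast_atTop_atTop.atTop_div_const hs).eventually_gt_atTop _
    filter_upwards [hev] with n hn
    have hpos : (0 : ℝ) < n / s := by linarith
    have h := hf.2 n (n / s) hpos
    rw [iteratedDerivWithin_of_isOpen isOpen_Ioi hpos, iteratedDeriv_eq_inverseSeries hR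
      (abs_bmpCoeff_le hα) (fun y hy => exp_sub_rpow_eq_inverseSeries hα hy) n hn, ← mul_assoc,
      ← mul_pow] at h
    simp only [neg_mul_neg, one_mul, one_pow] at h
    positivity

/-- `f_α(x) = e^α − (1+1/x)^{αx}` is completely monotonic iff `φ_α ≥ 0` on `[0,∞)`;
in that case `φ_α` is integrable on `[0,∞)` with `∫_0^∞ φ_α(s) ds = e^α − 1`. -/
theorem stmt4 (α : ℝ) (hα : 0 < α) :
    (CompletelyMonotonicOn (fun x : ℝ => Real.exp α - (1 + 1 / x) ^ (α * x)) ↔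
      ∀ s : ℝ, 0 ≤ s → 0 ≤ bmpPhiR α s) ∧
    (CompletelyMonotonicOn (fun x : ℝ => Real.exp α - (1 + 1 / x) ^ (α * x)) →
      MeasureTheory.IntegrableOn (bmpPhiR α) (Set.Ici 0) ∧
        ∫ s in Set.Ioi (0 : ℝ), bmpPhiR α s = Real.exp α - 1) := by
  have hm := measurable_bmpPhiR hα.le
  refine ⟨⟨fun hf s hs => bmpPhiR_nonneg_of_completelyMonotonicOn hα.le hf hs, fun hφ => ?_⟩,
    fun hf => ?_⟩
  · exact completelyMonotonicOn_of_laplace hm (fun t ht => hφ t ht.le)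
      (fun x hx => (laplace_bmpPhiR hα.le hφ hx).1) fun x hx => (laplace_bmpPhiR hα.le hφ hx).2
  · have hφ (s : ℝ) (hs : 0 ≤ s) : 0 ≤ bmpPhiR α s :=
      bmpPhiR_nonneg_of_completelyMonotonicOn hα.le hf hs
    rw [integrableOn_Ici_iff_integrableOn_Ioi]
    exact integral_of_laplace hm (fun t ht => hφ t ht.le)
      (fun x hx => (laplace_bmpPhiR hα.le hφ hx).1) (fun x hx => (laplace_bmpPhiR hα.le hφ hx).2)
      (tendsto_exp_sub_rpow α)
end

section
/- Let 0 < α < 1. For every z ∈ ℂ with z ∉ [−1,0] one has f_α(z) = (1/π) ∫_0^1 [(x/(1−x))^{αx} sin(απx)] / (x+z) dx, the integrand being integrable on (0,1). In particular, for real x > 0, f_α(x) = e^α − (1+1/x)^{αx} is a Stieltjes function. -/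
open MeasureTheory Filter Set Asymptotics

/-- A Stieltjes function: `f(x) = a + ∫_{[0,∞)} (x+t)⁻¹ dμ(t)` with `a ≥ 0` and `μ` a positive
measure on `[0,∞)` such that `∫ (1+t)⁻¹ dμ(t) < ∞`. -/
def IsStieltjesFun (f : ℝ → ℝ) : Prop :=
  ∃ (a : ℝ) (μ : MeasureTheory.Measure ℝ), 0 ≤ a ∧ μ (Set.Iio 0) = 0 ∧
    MeasureTheory.Integrable (fun t : ℝ => (1 + t)⁻¹) μ ∧
    ∀ x : ℝ, 0 < x → f x = a + ∫ t, (x + t)⁻¹ ∂μ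

theorem exp_inj_of_abs_im_sub_lt {w c : ℂ} (h : |w.im - c.im| < 2 * Real.pi)
    (he : Complex.exp w = Complex.exp c) : w = c := by
  obtain ⟨n, hn⟩ := Complex.exp_eq_exp_iff_exists_int.1 he
  have him : w.im - c.im = n * (2 * Real.pi) := by
    rw [hn]; simp
  have hn0 : n = 0 := by
    rw [him, abs_mul, abs_of_pos Real.two_pi_pos] at h
    have h2 : |(n : ℝ)| < 1 := by
      by_contra! hcon
      nlinarith [Real.two_pi_pos]
    exact Int.abs_lt_one_iff.1 (by exact_mod_cast h2)
  simpa [hn0] using hn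

theorem dslope_exp_ne_zero {w c : ℂ} (h : |w.im - c.im| < 2 * Real.pi) :
    dslope Complex.exp c w ≠ 0 := by
  rcases eq_or_ne w c with rfl | hne
  · simp
  · rw [dslope_of_ne _ hne, slope_def_field]
    exact div_ne_zero (sub_ne_zero.2 fun he => hne (exp_inj_of_abs_im_sub_lt h he))
      (sub_ne_zero.2 hne)

/-- The holomorphic extension of `exp (α w / (e^w - 1))` to the strip `|Im w| < 2π`. -/
noncomputable def toddExp (α w : ℂ) : ℂ :=
  Complex.exp (α * (dslope Complex.exp 0 w)⁻¹)

theorem toddExp_zero (α : ℂ) : toddExp α 0 = Complex.exp α := by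
  simp [toddExp]

theorem toddExp_of_ne {α w : ℂ} (hw : w ≠ 0) :
    toddExp α w = Complex.exp (α * (w / (Complex.exp w - 1))) := by
  simp [toddExp, dslope_of_ne _ hw, slope_def_field]

theorem isOpen_strip (r : ℝ) : IsOpen {w : ℂ | |w.im| < r} :=
  isOpen_lt (by fun_prop) continuous_const

theorem differentiableOn_toddExp (α : ℂ) :
    DifferentiableOn ℂ (toddExp α) {w | |w.im| < 2 * Real.pi} := by
  have h0 : {w : ℂ | |w.im| < 2 * Real.pi} ∈ nhds (0 : ℂ) :=
    (isOpen_strip _).mem_nhds (by simp [Real.pi_pos])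
  have h1 : DifferentiableOn ℂ (dslope Complex.exp 0) {w | |w.im| < 2 * Real.pi} :=
    (Complex.differentiableOn_dslope h0).2 Complex.differentiable_exp.differentiableOn
  have h2 := h1.inv fun w (hw : |w.im| < _) => dslope_exp_ne_zero (by simpa using hw)
  exact (h2.const_mul α).cexp

/-- The holomorphic extension of `(G w - G c) e^w / (e^w - e^c)` through `w = c`,
where `G = toddExp α`. -/
noncomputable def toddKernel (α c w : ℂ) : ℂ :=
  dslope (toddExp α) c w / dslope Complex.exp c w * Complex.exp w

theorem toddKernel_of_ne {α c w : ℂ} (hw : w ≠ c) :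
    toddKernel α c w =
      (toddExp α w - toddExp α c) * Complex.exp w / (Complex.exp w - Complex.exp c) := by
  have : w - c ≠ 0 := sub_ne_zero.2 hw
  rw [toddKernel, dslope_of_ne _ hw, dslope_of_ne _ hw, slope_def_field, slope_def_field,
    div_div_div_cancel_right₀ this, div_mul_eq_mul_div]

theorem differentiableOn_toddKernel (α : ℂ) {c : ℂ} (hc : |c.im| < Real.pi) :
    DifferentiableOn ℂ (toddKernel α c) {w | |w.im| ≤ Real.pi} := by
  have hn : {w : ℂ | |w.im| < 2 * Real.pi} ∈ nhds c :=
    (isOpen_strip _).mem_nhds (show |c.im| < _ by linarith [Real.pi_pos])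
  have hsub : {w : ℂ | |w.im| ≤ Real.pi} ⊆ {w : ℂ | |w.im| < 2 * Real.pi} := fun w (hw : |w.im| ≤ _) =>
    show |w.im| < _ by linarith [Real.pi_pos]
  refine ((((Complex.differentiableOn_dslope hn).2 (differentiableOn_toddExp α)).mono hsub).div
    (((Complex.differentiableOn_dslope hn).2
      Complex.differentiable_exp.differentiableOn).mono hsub) fun w (hw : |w.im| ≤ _) => ?_).mul
    Complex.differentiable_exp.differentiableOn
  refine dslope_exp_ne_zero ((abs_sub _ _).trans_lt ?_)
  linarith

/-- The filter `Re w → +∞` inside the strip `|Im w| ≤ π`. -/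
noncomputable def stripTop : Filter ℂ :=
  comap Complex.re atTop ⊓ 𝓟 {w | |w.im| ≤ Real.pi}

/-- The filter `Re w → -∞` inside the strip `|Im w| ≤ π`. -/
noncomputable def stripBot : Filter ℂ :=
  comap Complex.re atBot ⊓ 𝓟 {w | |w.im| ≤ Real.pi}

theorem tendsto_re_stripTop : Tendsto Complex.re stripTop atTop :=
  tendsto_comap.mono_left inf_le_left

theorem tendsto_re_stripBot : Tendsto Complex.re stripBot atBot :=
  tendsto_comap.mono_left inf_le_left

theorem tendsto_neg_stripTop : Tendsto (fun w : ℂ => -w) stripTop stripBot := by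
  refine tendsto_inf.2 ⟨tendsto_comap_iff.2 ?_, tendsto_principal.2 ?_⟩
  · exact tendsto_neg_atTop_atBot.comp tendsto_re_stripTop
  · filter_upwards [mem_inf_of_right (mem_principal_self _)] with w hw
    simpa using hw

theorem tendsto_exp_mul_stripBot {b : ℝ} (hb : 0 < b) :
    Tendsto (fun w : ℂ => Complex.exp (b * w)) stripBot (nhds 0) := by
  rw [tendsto_zero_iff_norm_tendsto_zero]
  have h := Real.tendsto_exp_atBot.comp (tendsto_re_stripBot.const_mul_atBot hb)
  refine h.congr fun w => ?_
  simp [Complex.norm_exp]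

theorem tendsto_exp_stripBot : Tendsto Complex.exp stripBot (nhds 0) := by
  simpa using tendsto_exp_mul_stripBot one_pos

theorem tendsto_mul_exp_stripBot :
    Tendsto (fun w : ℂ => w * Complex.exp w) stripBot (nhds 0) := by
  have h1 : Tendsto (fun x : ℝ => |x| * Real.exp x + Real.pi * Real.exp x) atBot (nhds 0) := by
    have h2 : Tendsto (fun x : ℝ => |x| * Real.exp x) atBot (nhds 0) := by
      have h3 := (Real.tendsto_pow_mul_exp_neg_atTop_nhds_zero 1).comp tendsto_neg_atBot_atTop
      refine h3.congr' ?_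
      filter_upwards [eventually_le_atBot 0] with x hx
      simp [abs_of_nonpos hx]
    simpa using h2.add (Real.tendsto_exp_atBot.const_mul Real.pi)
  refine squeeze_zero_norm' ?_ (h1.comp tendsto_re_stripBot)
  filter_upwards [mem_inf_of_right (mem_principal_self _)] with w (hw : |w.im| ≤ _)
  rw [norm_mul, Complex.norm_exp, Function.comp, ← add_mul]
  gcongr
  exact (Complex.norm_le_abs_re_add_abs_im w).trans (by linarith)

theorem tendsto_toddExp_stripTop (α : ℂ) : Tendsto (toddExp α) stripTop (nhds 1) := by
  have h1 := tendsto_mul_exp_stripBot.comp tendsto_neg_stripTop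
  have h2 := tendsto_exp_stripBot.comp tendsto_neg_stripTop
  have h3 := ((h1.div (h2.sub_const 1) (by simp)).const_mul α).cexp
  simp only [zero_div, mul_zero, Complex.exp_zero] at h3
  refine h3.congr' ?_
  filter_upwards [tendsto_re_stripTop.eventually_gt_atTop 0] with w hw
  have hw0 : w ≠ 0 := fun h => by simp [h] at hw
  rw [toddExp_of_ne hw0]
  have he := Complex.exp_ne_zero w
  congr 2
  simp only [Function.comp, Complex.exp_neg, Pi.div_apply]
  rw [show w / (Complex.exp w - 1) =
    (-(w * (Complex.exp w)⁻¹)) / (-((Complex.exp w - 1) * (Complex.exp w)⁻¹)) by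
      rw [neg_div_neg_eq, mul_div_mul_right _ _ (inv_ne_zero he)]]
  congr 1
  · ring
  · field_simp
    ring

theorem tendsto_toddKernel_stripTop (α c : ℂ) :
    Tendsto (toddKernel α c) stripTop (nhds (1 - toddExp α c)) := by
  have h2 := tendsto_exp_stripBot.comp tendsto_neg_stripTop
  have h3 := ((tendsto_toddExp_stripTop α).sub_const (toddExp α c)).div
    ((h2.const_mul (Complex.exp c)).const_sub 1) (by simp)
  simp only [mul_zero, sub_zero, div_one] at h3
  refine h3.congr' ?_
  filter_upwards [tendsto_re_stripTop.eventually_gt_atTop c.re] with w hw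
  have hw0 : w ≠ c := fun h => by simp [h] at hw
  rw [toddKernel_of_ne hw0]
  have he := Complex.exp_ne_zero w
  simp only [Function.comp, Complex.exp_neg, Pi.div_apply]
  rw [← mul_div_mul_right _ (1 - _) he]
  congr 1
  field_simp

theorem tendsto_toddKernel_stripBot {α : ℝ} (h1 : α < 1) (c : ℂ) :
    Tendsto (toddKernel α c) stripBot (nhds 0) := by
  have hb : 0 < 1 - α := by linarith
  have h2 := ((tendsto_mul_exp_stripBot.div (tendsto_exp_stripBot.sub_const 1)
    (by simp)).const_mul (α : ℂ)).cexp
  have h3 := (((tendsto_exp_mul_stripBot hb).mul h2).sub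
    (tendsto_exp_stripBot.const_mul (toddExp α c))).div
      (tendsto_exp_stripBot.sub_const (Complex.exp c)) (by simp)
  simp only [mul_zero, zero_mul, sub_zero, zero_div] at h3
  refine h3.congr' ?_
  filter_upwards [tendsto_re_stripBot.eventually_lt_atBot c.re,
    tendsto_re_stripBot.eventually_lt_atBot 0] with w hw hw'
  have hwc : w ≠ c := fun h => by simp [h] at hw
  have hw0 : w ≠ 0 := fun h => by simp [h] at hw'
  have he : Complex.exp w - 1 ≠ 0 := fun h => by
    have := congrArg norm (sub_eq_zero.1 h)
    simp only [Complex.norm_exp, norm_one, Real.exp_eq_one_iff] at this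
    exact hw'.ne this
  rw [toddKernel_of_ne hwc, toddExp_of_ne hw0]
  simp only [Pi.div_apply]
  rw [sub_mul, ← Complex.exp_add, ← Complex.exp_add]
  congr 3
  push_cast
  field_simp
  ring

theorem tendsto_integral_vertical {F : ℂ → ℂ} {L : ℂ} {l : Filter ℂ} {k : Filter ℝ}
    [k.IsCountablyGenerated]
    (hl : l = comap Complex.re k ⊓ 𝓟 {w | |w.im| ≤ Real.pi})
    (hF : ContinuousOn F {w | |w.im| ≤ Real.pi}) (hlim : Tendsto F l (nhds L)) :
    Tendsto (fun S : ℝ => ∫ y in (-Real.pi)..Real.pi, F (S + y * Complex.I)) k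
      (nhds (2 * Real.pi * L)) := by
  have hpi : -Real.pi ≤ Real.pi := by linarith [Real.pi_pos]
  have hconst : ∫ y in (-Real.pi)..Real.pi, L = 2 * Real.pi * L := by
    rw [intervalIntegral.integral_const, Complex.real_smul]
    push_cast
    ring
  rw [← hconst]
  have hbd : ∀ᶠ w in l, ‖F w‖ ≤ ‖L‖ + 1 :=
    hlim.norm.eventually (Iic_mem_nhds (by linarith))
  rw [hl, eventually_inf_principal, eventually_comap] at hbd
  refine intervalIntegral.tendsto_integral_filter_of_dominated_convergence
    (fun _ => ‖L‖ + 1) (Eventually.of_forall fun S => ?_) ?_ intervalIntegrable_const ?_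
  · rw [uIoc_of_le hpi]
    refine ContinuousOn.aestronglyMeasurable (hF.comp (by fun_prop) fun y hy => ?_)
      measurableSet_Ioc
    simpa [abs_le] using ⟨hy.1.le, hy.2⟩
  · filter_upwards [hbd] with S hS
    refine Eventually.of_forall fun y hy => hS _ (by simp) ?_
    rw [uIoc_of_le hpi] at hy
    simpa [abs_le] using ⟨hy.1.le, hy.2⟩
  · refine Eventually.of_forall fun y hy => hlim.comp ?_
    rw [uIoc_of_le hpi] at hy
    rw [hl]
    refine tendsto_inf.2 ⟨tendsto_comap_iff.2 ?_, tendsto_principal.2 ?_⟩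
    · refine tendsto_id.congr fun S => ?_
      simp
    · refine Eventually.of_forall fun S => ?_
      simpa [abs_le] using ⟨hy.1.le, hy.2⟩

/-- The density `(x/(1-x))^{αx} sin(απx)`. -/
noncomputable def bmpDensity (α x : ℝ) : ℝ :=
  (x / (1 - x)) ^ (α * x) * Real.sin (α * Real.pi * x)

/-- The decreasing bijection `s ↦ 1/(1+e^s)` from `ℝ` onto `(0,1)`. -/
noncomputable def logisticNeg (s : ℝ) : ℝ := (1 + Real.exp s)⁻¹

theorem exp_add_pi_I (s : ℝ) : Complex.exp (s + Real.pi * Complex.I) = -(Real.exp s : ℂ) := by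
  rw [Complex.exp_add, Complex.exp_pi_mul_I]; simp

theorem exp_sub_pi_I (s : ℝ) :
    Complex.exp (s + (-Real.pi : ℝ) * Complex.I) = -(Real.exp s : ℂ) := by
  rw [Complex.exp_add]
  push_cast
  rw [neg_mul, Complex.exp_neg, Complex.exp_pi_mul_I]
  norm_num

theorem ne_of_im_abs {w c : ℂ} (h : |c.im| < |w.im|) : w ≠ c := by
  rintro rfl
  exact lt_irrefl _ h

theorem one_add_exp_ne_zero (s : ℝ) : (1 + Real.exp s : ℂ) ≠ 0 := by
  exact_mod_cast (by positivity : (1 + Real.exp s) ≠ 0)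

theorem toddExp_boundary_sub (α s : ℝ) :
    toddExp α (s + (-Real.pi : ℝ) * Complex.I) - toddExp α (s + Real.pi * Complex.I) =
      2 * Complex.I * bmpDensity α (logisticNeg s) := by
  have hX : logisticNeg s / (1 - logisticNeg s) = Real.exp (-s) := by
    have : 1 + Real.exp s ≠ 0 := by positivity
    have h2 : Real.exp s ≠ 0 := by positivity
    rw [logisticNeg, Real.exp_neg]
    rw [show 1 - (1 + Real.exp s)⁻¹ = Real.exp s * (1 + Real.exp s)⁻¹ by field_simp; ring]
    field_simp
  have hpi := Real.pi_pos
  rw [toddExp_of_ne (ne_of_im_abs (by simp [hpi.ne'])),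
    toddExp_of_ne (ne_of_im_abs (by simp [hpi.ne'])), exp_add_pi_I, exp_sub_pi_I,
    bmpDensity, hX, ← Real.exp_mul]
  have h1 := one_add_exp_ne_zero s
  have h2 : (-(Real.exp s : ℂ) - 1) ≠ 0 := by
    rw [show (-(Real.exp s : ℂ) - 1) = -(1 + Real.exp s) by ring]
    exact neg_ne_zero.2 h1
  set X := logisticNeg s with hXdef
  have e1 : (α : ℂ) * ((s + (-Real.pi : ℝ) * Complex.I) / (-(Real.exp s : ℂ) - 1)) =
      (-s * (α * X) : ℝ) + (α * Real.pi * X : ℝ) * Complex.I := by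
    rw [hXdef, logisticNeg]
    push_cast at h1 h2 ⊢
    field_simp
    ring
  have e2 : (α : ℂ) * ((s + Real.pi * Complex.I) / (-(Real.exp s : ℂ) - 1)) =
      (-s * (α * X) : ℝ) + -((α * Real.pi * X : ℝ) * Complex.I) := by
    rw [hXdef, logisticNeg]
    push_cast at h1 h2 ⊢
    field_simp
    ring
  rw [e1, e2, Complex.exp_add, Complex.exp_add, ← neg_mul, Complex.exp_mul_I, Complex.exp_mul_I,
    Complex.cos_neg, Complex.sin_neg]
  push_cast
  ring

theorem rect_identity (α : ℝ) {c : ℂ} (hc : |c.im| < Real.pi) (S : ℝ) :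
    (∫ s in (-S)..S, 2 * Complex.I * bmpDensity α (logisticNeg s) *
        (Real.exp s / (Real.exp s + Complex.exp c))) +
      Complex.I * (∫ y in (-Real.pi)..Real.pi, toddKernel α c (S + y * Complex.I)) -
      Complex.I * (∫ y in (-Real.pi)..Real.pi, toddKernel α c ((-S : ℝ) + y * Complex.I)) = 0 := by
  have hpi := Real.pi_pos
  have hd := differentiableOn_toddKernel (α : ℂ) hc
  have hrect := Complex.integral_boundary_rect_eq_zero_of_differentiableOn (toddKernel α c)
    ⟨-S, -Real.pi⟩ ⟨S, Real.pi⟩ (hd.mono fun w hw => by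
      have := hw.2
      simp only [mem_preimage, uIcc_of_le (by linarith : -Real.pi ≤ Real.pi)] at this
      exact abs_le.2 this)
  simp only [smul_eq_mul] at hrect
  rw [← hrect]
  congr 2
  have hint : ∀ b : ℝ, |b| = Real.pi →
      IntervalIntegrable (fun s : ℝ => toddKernel α c (s + b * Complex.I)) volume (-S) S := by
    intro b hb
    refine ContinuousOn.intervalIntegrable (hd.continuousOn.comp (by fun_prop) fun s _ => ?_)
    simp [hb]
  rw [← intervalIntegral.integral_sub (hint _ (by simp [hpi.le])) (hint _ (by simp [hpi.le]))]
  refine intervalIntegral.integral_congr fun s _ => ?_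
  have hne1 : (s + (-Real.pi : ℝ) * Complex.I) ≠ c :=
    ne_of_im_abs (by simpa [abs_of_pos hpi] using hc)
  have hne2 : (s + Real.pi * Complex.I) ≠ c :=
    ne_of_im_abs (by simpa [abs_of_pos hpi] using hc)
  rw [toddKernel_of_ne hne1, toddKernel_of_ne hne2, ← toddExp_boundary_sub, exp_add_pi_I,
    exp_sub_pi_I, show -(Real.exp s : ℂ) - Complex.exp c = -(Real.exp s + Complex.exp c) by ring,
    div_neg, div_neg]
  ring

theorem hasDerivAt_logisticNeg (s : ℝ) :
    HasDerivAt logisticNeg (-Real.exp s / (1 + Real.exp s) ^ 2) s :=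
  ((Real.hasDerivAt_exp s).const_add 1).inv (by positivity)

theorem injective_logisticNeg : Function.Injective logisticNeg := fun a b h => by
  simpa [logisticNeg] using h

theorem range_logisticNeg : logisticNeg '' univ = Ioo 0 1 := by
  ext x
  simp only [image_univ, mem_range, mem_Ioo]
  constructor
  · rintro ⟨s, rfl⟩
    have := Real.exp_pos s
    exact ⟨by unfold logisticNeg; positivity, inv_lt_one_of_one_lt₀ (by linarith)⟩
  · rintro ⟨h0, h1⟩
    refine ⟨Real.log ((1 - x) / x), ?_⟩
    rw [logisticNeg, Real.exp_log (div_pos (by linarith) h0)]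
    field_simp
    ring

theorem continuousOn_bmpDensity (α : ℝ) : ContinuousOn (bmpDensity α) (Ioo 0 1) := by
  refine ContinuousOn.mul (ContinuousOn.rpow ?_ (by fun_prop) fun x hx => Or.inl ?_) (by fun_prop)
  · exact continuousOn_id.div (by fun_prop) fun x hx => (sub_pos.2 hx.2).ne'
  · exact (div_pos hx.1 (sub_pos.2 hx.2)).ne'

theorem abs_bmpDensity_le {α x : ℝ} (h0 : 0 ≤ α) (hx : x ∈ Ioo (0 : ℝ) 1) :
    |bmpDensity α x| ≤ (1 - x) ^ (-α) := by
  have h1x : 0 < 1 - x := sub_pos.2 hx.2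
  have hq : 0 ≤ x / (1 - x) := (div_pos hx.1 h1x).le
  rw [bmpDensity, abs_mul, abs_of_nonneg (Real.rpow_nonneg hq _)]
  calc (x / (1 - x)) ^ (α * x) * |Real.sin (α * Real.pi * x)|
      ≤ (x / (1 - x)) ^ (α * x) * 1 := by
        gcongr
        exact Real.abs_sin_le_one _
    _ = (x / (1 - x)) ^ (α * x) := mul_one _
    _ ≤ ((1 - x)⁻¹) ^ (α * x) := by
        refine Real.rpow_le_rpow hq ?_ (mul_nonneg h0 hx.1.le)
        rw [div_eq_mul_inv]
        exact mul_le_of_le_one_left (inv_nonneg.2 h1x.le) hx.2.le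
    _ ≤ ((1 - x)⁻¹) ^ α := by
        refine Real.rpow_le_rpow_of_exponent_le ((one_le_inv₀ h1x).2 (by linarith [hx.1])) ?_
        exact mul_le_of_le_one_right h0 hx.2.le
    _ = (1 - x) ^ (-α) := by rw [Real.inv_rpow h1x.le, Real.rpow_neg h1x.le]

theorem integrableOn_bmpDensity {α : ℝ} (h0 : 0 ≤ α) (h1 : α < 1) :
    IntegrableOn (bmpDensity α) (Ioo 0 1) := by
  have hI : IntervalIntegrable (fun x : ℝ => (1 - x) ^ (-α)) volume 0 1 := by
    have := (intervalIntegral.intervalIntegrable_rpow' (a := 1) (b := 0)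
      (by linarith : -1 < -α)).comp_sub_left 1
    simpa using this
  rw [intervalIntegrable_iff_integrableOn_Ioo_of_le zero_le_one] at hI
  refine Integrable.mono' hI
    ((continuousOn_bmpDensity α).aestronglyMeasurable measurableSet_Ioo) ?_
  exact (ae_restrict_iff' measurableSet_Ioo).2 (Eventually.of_forall fun x hx =>
    abs_bmpDensity_le h0 hx)

theorem ofReal_add_ne_zero {z : ℂ} (hz : z ∉ segment ℝ (-1 : ℂ) 0) {x : ℝ}
    (hx : x ∈ Icc (0 : ℝ) 1) : (x : ℂ) + z ≠ 0 := by
  intro h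
  refine hz ⟨x, 1 - x, hx.1, sub_nonneg.2 hx.2, by ring, ?_⟩
  simp only [smul_neg, Complex.real_smul, mul_one, smul_zero, add_zero]
  linear_combination -h

theorem integrableOn_bmpDensity_div {α : ℝ} (h0 : 0 ≤ α) (h1 : α < 1) {z : ℂ}
    (hz : z ∉ segment ℝ (-1 : ℂ) 0) :
    IntegrableOn (fun x : ℝ => (bmpDensity α x : ℂ) / (x + z)) (Ioo 0 1) := by
  have h : IntegrableOn (fun x : ℝ => (bmpDensity α x : ℂ)) (Ioo 0 1) :=
    (integrableOn_bmpDensity h0 h1).ofReal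
  rw [← integrableOn_Icc_iff_integrableOn_Ioo] at h ⊢
  refine h.mul_continuousOn (g' := fun x : ℝ => ((x : ℂ) + z)⁻¹) ?_ isCompact_Icc
  exact ContinuousOn.inv₀ (by fun_prop) fun x hx => ofReal_add_ne_zero hz hx

theorem one_add_one_div_mem_slitPlane {z : ℂ} (hz : z ∉ segment ℝ (-1 : ℂ) 0) :
    1 + 1 / z ∈ Complex.slitPlane := by
  have hz0 : z ≠ 0 := by
    rintro rfl
    exact hz (right_mem_segment ℝ _ _)
  rw [Complex.mem_slitPlane_iff_not_le_zero, Complex.le_def]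
  rintro ⟨hre, him⟩
  set r := (1 + 1 / z).re with hr
  have hu : 1 + 1 / z = (r : ℂ) := Complex.ext (by simp [hr]) (by simpa using him)
  have hr0 : r ≤ 0 := by simpa using hre
  have hne : (1 - r : ℂ) ≠ 0 := by
    exact_mod_cast (by linarith : (0 : ℝ) < 1 - r).ne'
  refine ofReal_add_ne_zero hz (x := (1 - r)⁻¹)
    ⟨inv_nonneg.2 (by linarith), inv_le_one_of_one_le₀ (by linarith)⟩ ?_
  have h1 : 1 / z = -(1 - r : ℂ) := by rw [← sub_eq_zero, ← sub_eq_zero.2 hu]; ring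
  have h2 : z = -(1 - r : ℂ)⁻¹ := by
    rw [← inv_neg, ← h1, one_div, inv_inv]
  rw [h2]
  push_cast
  ring

theorem kernel_change_of_variables {z : ℂ} (hz : z ∉ segment ℝ (-1 : ℂ) 0) (s : ℝ) :
    ((|-Real.exp s / (1 + Real.exp s) ^ 2| : ℝ) : ℂ) / (logisticNeg s + z) =
      Real.exp s / (Real.exp s + 1) - Real.exp s / (Real.exp s + (1 + 1 / z)) := by
  have hz0 : z ≠ 0 := by
    rintro rfl
    exact hz (right_mem_segment ℝ _ _)
  have hX : logisticNeg s ∈ Ioo (0 : ℝ) 1 := range_logisticNeg ▸ mem_image_of_mem _ (mem_univ s)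
  have hne := ofReal_add_ne_zero hz (Ioo_subset_Icc_self hX)
  rw [abs_div, abs_neg, abs_of_pos (Real.exp_pos s), abs_of_nonneg (by positivity)]
  have h1 := one_add_exp_ne_zero s
  have h2 : (Real.exp s : ℂ) + 1 ≠ 0 := by rwa [add_comm]
  have he : (logisticNeg s : ℂ) + z =
      z * (Real.exp s + (1 + 1 / z)) / (1 + Real.exp s) := by
    rw [logisticNeg]
    push_cast at h1 ⊢
    field_simp
    ring
  have h3 : (Real.exp s : ℂ) + (1 + 1 / z) ≠ 0 := fun h => hne (by rw [he, h]; simp)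
  rw [he]
  generalize hP : (Real.exp s : ℂ) + (1 + 1 / z) = P at h3 ⊢
  have hq : z⁻¹ = P - Real.exp s - 1 := by rw [← hP]; ring
  push_cast at hq h1 h2 ⊢
  calc Complex.exp s / (1 + Complex.exp s) ^ 2 / (z * P / (1 + Complex.exp s))
      = z⁻¹ * (Complex.exp s / ((1 + Complex.exp s) * P)) := by field_simp
    _ = Complex.exp s / (Complex.exp s + 1) - Complex.exp s / P := by
        rw [hq]
        field_simp
        ring

theorem continuous_bmpDensity_logisticNeg (α : ℝ) :
    Continuous fun s => bmpDensity α (logisticNeg s) :=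
  (continuousOn_bmpDensity α).comp_continuous
    (continuous_iff_continuousAt.2 fun s => (hasDerivAt_logisticNeg s).continuousAt)
    fun s => range_logisticNeg ▸ mem_image_of_mem _ (mem_univ s)

theorem exp_add_exp_ne_zero {c : ℂ} (hc : |c.im| < Real.pi) (s : ℝ) :
    (Real.exp s : ℂ) + Complex.exp c ≠ 0 := by
  intro h
  have he : Complex.exp (s + Real.pi * Complex.I) = Complex.exp c := by
    rw [exp_add_pi_I]
    linear_combination -h
  have hpi := Real.pi_pos
  have heq := exp_inj_of_abs_im_sub_lt (by
    refine (abs_sub _ _).trans_lt ?_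
    simp only [Complex.add_im, Complex.ofReal_im, Complex.mul_im, Complex.ofReal_re,
      Complex.I_im, Complex.I_re, mul_one, mul_zero, add_zero, zero_add, abs_of_pos hpi]
    linarith) he
  exact ne_of_im_abs (by simpa [abs_of_pos hpi] using hc) heq

theorem bmpF_eq_integral {α : ℝ} (h0 : 0 ≤ α) (h1 : α < 1) {z : ℂ}
    (hz : z ∉ segment ℝ (-1 : ℂ) 0) :
    bmpF α z = (1 / Real.pi : ℝ) *
      ∫ x in Ioo (0 : ℝ) 1, (bmpDensity α x : ℂ) / (x + z) := by
  have hz0 : z ≠ 0 := by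
    rintro rfl
    exact hz (right_mem_segment ℝ _ _)
  set u := 1 + 1 / z with hu
  have hslit : u ∈ Complex.slitPlane := one_add_one_div_mem_slitPlane hz
  set c := Complex.log u with hc
  have hexpc : Complex.exp c = u := Complex.exp_log (Complex.slitPlane_ne_zero hslit)
  have hcim : |c.im| < Real.pi := by
    rw [hc, Complex.log_im]
    exact lt_of_le_of_ne (Complex.abs_arg_le_pi u) fun h => by
      rcases abs_eq Real.pi_pos.le |>.1 h with h | h
      · exact Complex.slitPlane_arg_ne_pi hslit h
      · exact (Complex.neg_pi_lt_arg u).ne' h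
  have hc0 : c ≠ 0 := by
    intro h
    rw [h, Complex.exp_zero, hu] at hexpc
    simp [hz0] at hexpc
  have hF : bmpF α z = toddExp α 0 - toddExp α c := by
    rw [toddExp_zero, toddExp_of_ne hc0, hexpc, bmpF, ← hu, ← hc, hu]
    congr 2
    field_simp
    simp
  have h0im : |(0 : ℂ).im| < Real.pi := by simp [Real.pi_pos]
  set F : ℝ → ℂ := fun x => (bmpDensity α x : ℂ) / (x + z) with hFdef
  set f' : ℝ → ℝ := fun s => -Real.exp s / (1 + Real.exp s) ^ 2 with hf'
  have hderiv : ∀ s ∈ univ, HasDerivWithinAt logisticNeg (f' s) univ s := fun s _ =>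
    (hasDerivAt_logisticNeg s).hasDerivWithinAt
  have hinj : InjOn logisticNeg univ := injective_logisticNeg.injOn
  have hint := (integrableOn_image_iff_integrableOn_abs_deriv_smul MeasurableSet.univ hderiv
    hinj F).1 (by rw [range_logisticNeg]; exact integrableOn_bmpDensity_div h0 h1 hz)
  have hval := integral_image_eq_integral_abs_deriv_smul MeasurableSet.univ hderiv hinj F
  rw [range_logisticNeg, setIntegral_univ] at hval
  rw [integrableOn_univ] at hint
  have hk : ∀ s, |f' s| • F (logisticNeg s) = bmpDensity α (logisticNeg s) *
      (Real.exp s / (Real.exp s + 1) - Real.exp s / (Real.exp s + u)) := fun s => by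
    rw [← kernel_change_of_variables hz, Complex.real_smul]
    ring
  have hlim := (intervalIntegral_tendsto_integral hint tendsto_neg_atTop_atBot
    tendsto_id).const_mul (2 * Complex.I)
  have hmain : ∀ S : ℝ, 2 * Complex.I * ∫ s in (-S)..S, |f' s| • F (logisticNeg s) =
      Complex.I * ((∫ y in (-Real.pi)..Real.pi, toddKernel α c (S + y * Complex.I)) -
        (∫ y in (-Real.pi)..Real.pi, toddKernel α c ((-S : ℝ) + y * Complex.I)) -
        ((∫ y in (-Real.pi)..Real.pi, toddKernel α 0 (S + y * Complex.I)) -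
        (∫ y in (-Real.pi)..Real.pi, toddKernel α 0 ((-S : ℝ) + y * Complex.I)))) := fun S => by
    have e1 := rect_identity α hcim S
    have e2 := rect_identity α h0im S
    have hI (d : ℂ) (hd : |d.im| < Real.pi) :
        IntervalIntegrable (fun s : ℝ => 2 * Complex.I * bmpDensity α (logisticNeg s) *
          (Real.exp s / (Real.exp s + Complex.exp d))) volume (-S) S := by
      have h1 := continuous_bmpDensity_logisticNeg α
      refine Continuous.intervalIntegrable (Continuous.mul (by fun_prop) ?_) _ _
      exact Continuous.div (by fun_prop) (by fun_prop) (exp_add_exp_ne_zero hd)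
    have e3 := intervalIntegral.integral_sub (hI 0 h0im) (hI c hcim)
    have e4 : 2 * Complex.I * ∫ s in (-S)..S, |f' s| • F (logisticNeg s) =
        ∫ s in (-S)..S, (2 * Complex.I * bmpDensity α (logisticNeg s) *
          (Real.exp s / (Real.exp s + Complex.exp 0)) -
          2 * Complex.I * bmpDensity α (logisticNeg s) *
          (Real.exp s / (Real.exp s + Complex.exp c))) := by
      rw [← intervalIntegral.integral_const_mul]
      refine intervalIntegral.integral_congr fun s _ => ?_
      simp only [hk, hexpc, Complex.exp_zero]
      ring
    rw [e4, e3]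
    linear_combination e2 - e1
  have hv (d : ℂ) (hd : |d.im| < Real.pi) := (tendsto_integral_vertical rfl
    (differentiableOn_toddKernel (α : ℂ) hd).continuousOn
      (tendsto_toddKernel_stripTop α d)).sub
    ((tendsto_integral_vertical rfl (differentiableOn_toddKernel (α : ℂ) hd).continuousOn
      (tendsto_toddKernel_stripBot h1 d)).comp tendsto_neg_atTop_atBot)
  have hlim2 := ((hv c hcim).sub (hv 0 h0im)).const_mul Complex.I
  have huniq := tendsto_nhds_unique (hlim.congr hmain) hlim2
  rw [← hval] at huniq
  rw [hF]
  have hpi : (Real.pi : ℂ) ≠ 0 := by exact_mod_cast Real.pi_ne_zero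
  have h2 : 2 * Complex.I ≠ 0 := by simp
  have h3 : ∫ x in Ioo (0 : ℝ) 1, F x = Real.pi * (toddExp α 0 - toddExp α c) := by
    apply mul_left_cancel₀ h2
    rw [huniq]
    ring
  rw [h3]
  push_cast
  field_simp

theorem bmpDensity_nonneg {α x : ℝ} (h0 : 0 ≤ α) (h1 : α ≤ 1) (hx : x ∈ Ioo (0 : ℝ) 1) :
    0 ≤ bmpDensity α x := by
  refine mul_nonneg (Real.rpow_nonneg (div_nonneg hx.1.le (sub_nonneg.2 hx.2.le)) _)
    (Real.sin_nonneg_of_nonneg_of_le_pi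
      (mul_nonneg (mul_nonneg h0 Real.pi_pos.le) hx.1.le) ?_)
  have : α * x ≤ 1 := mul_le_one₀ h1 hx.1.le hx.2.le
  nlinarith [Real.pi_pos]

theorem bmpF_ofReal (α : ℝ) {x : ℝ} (hx : 0 < x) :
    bmpF α x = ((Real.exp α - (1 + 1 / x) ^ (α * x) : ℝ) : ℂ) := by
  have h : 0 < 1 + 1 / x := by positivity
  rw [Real.rpow_def_of_pos h, bmpF]
  push_cast
  rw [Complex.ofReal_log h.le]
  push_cast
  congr 2
  ring

theorem notMem_segment_of_pos {x : ℝ} (hx : 0 < x) : (x : ℂ) ∉ segment ℝ (-1 : ℂ) 0 := by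
  rintro ⟨a, b, ha, hb, hab, h⟩
  have := congrArg Complex.re h
  simp at this
  linarith

theorem isStieltjesFun_of_density {f ρ : ℝ → ℝ} (hm : Measurable ρ)
    (hρ : ∀ x ∈ Ioo (0 : ℝ) 1, 0 ≤ ρ x) (hint : IntegrableOn ρ (Ioo 0 1))
    (hf : ∀ x : ℝ, 0 < x → f x = ∫ t in Ioo (0 : ℝ) 1, ρ t / (t + x)) : IsStieltjesFun f := by
  have hm' : Measurable fun t => (ρ t).toNNReal := hm.real_toNNReal
  have hsmul : ∀ t ∈ Ioo (0 : ℝ) 1, ∀ y : ℝ, (ρ t).toNNReal • y = ρ t * y := fun t ht y => by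
    rw [NNReal.smul_def, Real.coe_toNNReal _ (hρ t ht), smul_eq_mul]
  refine ⟨0, (volume.restrict (Ioo 0 1)).withDensity fun t => ((ρ t).toNNReal : ENNReal),
    le_rfl, ?_, ?_, fun x hx => ?_⟩
  · refine withDensity_absolutelyContinuous _ _ ?_
    rw [Measure.restrict_apply measurableSet_Iio]
    convert measure_empty (μ := (volume : Measure ℝ))
    ext t
    simp only [mem_inter_iff, mem_Iio, mem_Ioo, mem_empty_iff_false, iff_false]
    intro h
    linarith [h.1, h.2.1]
  · rw [integrable_withDensity_iff_integrable_smul hm']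
    have h : IntegrableOn (fun t => ρ t * (1 + t)⁻¹) (Ioo 0 1) := by
      rw [← integrableOn_Icc_iff_integrableOn_Ioo] at hint ⊢
      refine hint.mul_continuousOn ?_ isCompact_Icc
      exact ContinuousOn.inv₀ (by fun_prop) fun t ht => by linarith [ht.1]
    exact h.congr_fun (fun t ht => (hsmul t ht _).symm) measurableSet_Ioo
  · rw [integral_withDensity_eq_integral_smul hm', hf x hx, zero_add]
    refine setIntegral_congr_fun measurableSet_Ioo fun t ht => ?_
    simp only [hsmul t ht, add_comm x t, div_eq_mul_inv]

theorem measurable_bmpDensity (α : ℝ) : Measurable (bmpDensity α) := by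
  unfold bmpDensity
  fun_prop

/-- For `0 < α < 1`, `f_α(z) = (1/π)∫_0^1 (x/(1−x))^{αx} sin(απx)/(x+z) dx` for all
`z ∉ [−1,0]`; in particular `f_α` is a Stieltjes function on `(0,∞)`. -/
theorem stmt6 (α : ℝ) (h0 : 0 < α) (h1 : α < 1) :
    (∀ z : ℂ, z ∉ segment ℝ (-1 : ℂ) 0 →
      MeasureTheory.IntegrableOn
        (fun x : ℝ => (((x / (1 - x)) ^ (α * x) * Real.sin (α * Real.pi * x) : ℝ) : ℂ) /
          ((x : ℂ) + z)) (Set.Ioo 0 1) ∧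
      bmpF (α : ℂ) z = (1 / Real.pi : ℝ) * ∫ x in Set.Ioo (0 : ℝ) 1,
        (((x / (1 - x)) ^ (α * x) * Real.sin (α * Real.pi * x) : ℝ) : ℂ) / ((x : ℂ) + z)) ∧
    IsStieltjesFun (fun x : ℝ => Real.exp α - (1 + 1 / x) ^ (α * x)) := by
  refine ⟨fun z hz => ⟨integrableOn_bmpDensity_div h0.le h1 hz, bmpF_eq_integral h0.le h1 hz⟩, ?_⟩
  refine isStieltjesFun_of_density (ρ := fun t => (1 / Real.pi) * bmpDensity α t)
    ((measurable_bmpDensity α).const_mul _)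
    (fun x hx => mul_nonneg (by positivity) (bmpDensity_nonneg h0.le h1.le hx))
    ((integrableOn_bmpDensity h0.le h1).const_mul _) fun x hx => ?_
  have h := bmpF_eq_integral h0.le h1 (notMem_segment_of_pos hx)
  rw [bmpF_ofReal α hx] at h
  apply Complex.ofReal_injective
  rw [h, ← integral_complex_ofReal, ← integral_const_mul]
  refine integral_congr_ae (Eventually.of_forall fun t => ?_)
  push_cast
  ring
end

section
/- Define u(α,x) = (x/(1−x))^{αx} sin(απx) for 0 ≤ x < 1 and 0 < α ≤ 1, and w(α,x) = u(α,x) − u(1,x) for 0 < α < 1. Then for every continuous function φ : [0,1] → ℝ, lim_{α→1⁻} (1/π) ∫_0^1 w(α,x) φ(x) dx = φ(1). -/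
open MeasureTheory Filter Set

/-- `u(α,x) = (x/(1−x))^{αx} sin(απx)`. -/
noncomputable def bmpU (α x : ℝ) : ℝ := (x / (1 - x)) ^ (α * x) * Real.sin (α * Real.pi * x)

/-- The part of `u(α, 1 - t)` that stays bounded as `α → 1`. -/
noncomputable def bmpRegular (α t : ℝ) : ℝ :=
  Real.cos (Real.pi * (1 - α)) * (((1 - t) / t) ^ (α * (1 - t)) * Real.sin (Real.pi * α * t))

/-- The bounded factor of the part of `u(α, 1 - t)` that concentrates at `t = 0`. -/
noncomputable def bmpPeakFactor (α t : ℝ) : ℝ :=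
  (1 - t) ^ (α * (1 - t)) * (t ^ t) ^ α * Real.cos (Real.pi * α * t)

lemma bmpU_one_sub (α : ℝ) {t : ℝ} (ht : t ∈ Ioo (0 : ℝ) 1) :
    bmpU α (1 - t) =
      Real.sin (Real.pi * (1 - α)) * (t ^ (-α) * bmpPeakFactor α t) + bmpRegular α t := by
  obtain ⟨h0, h1⟩ := ht
  have hsin : Real.sin (α * Real.pi * (1 - t)) =
      Real.sin (Real.pi * (1 - α)) * Real.cos (Real.pi * α * t) +
        Real.cos (Real.pi * (1 - α)) * Real.sin (Real.pi * α * t) := by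
    rw [← Real.sin_add, ← Real.sin_pi_sub]
    congr 1
    ring
  have hpow : ((1 - t) / t) ^ (α * (1 - t)) =
      t ^ (-α) * ((1 - t) ^ (α * (1 - t)) * (t ^ t) ^ α) := by
    rw [Real.div_rpow (by linarith) h0.le, ← Real.rpow_mul h0.le, div_eq_mul_inv,
      ← Real.rpow_neg h0.le, mul_left_comm, ← Real.rpow_add h0]
    congr 2
    ring
  rw [bmpU, sub_sub_cancel, hsin, bmpRegular, bmpPeakFactor, mul_add, hpow]
  ring

lemma measurable_bmpRegular (α : ℝ) : Measurable (bmpRegular α) := by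
  unfold bmpRegular
  fun_prop

lemma measurable_bmpPeakFactor (α : ℝ) : Measurable (bmpPeakFactor α) := by
  unfold bmpPeakFactor
  fun_prop

lemma abs_bmpRegular_le {α t : ℝ} (hα : α ∈ Icc (0 : ℝ) 1) (ht : t ∈ Ioo (0 : ℝ) 1) :
    |bmpRegular α t| ≤ Real.pi := by
  obtain ⟨h0, h1⟩ := ht
  obtain ⟨ha0, ha1⟩ := hα
  have hs0 : 0 ≤ α * (1 - t) := mul_nonneg ha0 (by linarith)
  have hs1 : α * (1 - t) ≤ 1 := by nlinarith
  have hpow : ((1 - t) / t) ^ (α * (1 - t)) ≤ t⁻¹ := by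
    rw [Real.div_rpow (by linarith) h0.le, div_eq_mul_inv]
    calc (1 - t) ^ (α * (1 - t)) * (t ^ (α * (1 - t)))⁻¹
        ≤ 1 * (t ^ (1 : ℝ))⁻¹ := by
          refine mul_le_mul (Real.rpow_le_one (by linarith) (by linarith) hs0) ?_
            (by positivity) zero_le_one
          exact inv_anti₀ (by positivity) (Real.rpow_le_rpow_of_exponent_ge h0 h1.le hs1)
      _ = t⁻¹ := by simp
  have hpow0 : 0 ≤ ((1 - t) / t) ^ (α * (1 - t)) :=
    Real.rpow_nonneg (div_nonneg (by linarith) h0.le) _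
  have hsin : |Real.sin (Real.pi * α * t)| ≤ Real.pi * t := by
    refine Real.abs_sin_le_abs.trans ?_
    rw [abs_of_nonneg (by positivity)]
    have : α * t ≤ t := by nlinarith
    nlinarith [Real.pi_pos]
  rw [bmpRegular, abs_mul, abs_mul, abs_of_nonneg hpow0]
  calc _ ≤ 1 * (t⁻¹ * (Real.pi * t)) :=
        mul_le_mul (Real.abs_cos_le_one _)
          (mul_le_mul hpow hsin (abs_nonneg _) (by positivity)) (by positivity) zero_le_one
    _ = Real.pi := by field_simp

lemma abs_bmpPeakFactor_le_one {α t : ℝ} (hα : 0 ≤ α) (ht : t ∈ Ioo (0 : ℝ) 1) :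
    |bmpPeakFactor α t| ≤ 1 := by
  obtain ⟨h0, h1⟩ := ht
  have h1t : 0 ≤ 1 - t := by linarith
  rw [bmpPeakFactor, abs_mul, abs_mul, abs_of_nonneg (Real.rpow_nonneg h1t _),
    abs_of_nonneg (by positivity : 0 ≤ (t ^ t) ^ α)]
  refine mul_le_one₀ (mul_le_one₀ ?_ (by positivity) ?_) (abs_nonneg _) (Real.abs_cos_le_one _)
  · exact Real.rpow_le_one h1t (by linarith) (by positivity)
  · exact Real.rpow_le_one (by positivity) (Real.rpow_le_one h0.le h1.le h0.le) hα

lemma tendsto_bmpRegular {t : ℝ} (ht : t ∈ Ioo (0 : ℝ) 1) :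
    Tendsto (fun α => bmpRegular α t) (nhds 1) (nhds (bmpRegular 1 t)) := by
  have hpos : (1 - t) / t ≠ 0 := (div_pos (by linarith [ht.2]) ht.1).ne'
  have : Continuous fun α => bmpRegular α t := by
    unfold bmpRegular
    refine Continuous.mul (by fun_prop) (Continuous.mul ?_ (by fun_prop))
    exact Continuous.rpow continuous_const (by fun_prop) fun _ => Or.inl hpos
  exact this.tendsto 1

lemma tendsto_rpow_self_nhdsGT_zero :
    Tendsto (fun t : ℝ => t ^ t) (nhdsWithin 0 (Ioi 0)) (nhds 1) := by
  have h := (Real.continuous_exp.tendsto 0).comp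
    (by simpa using tendsto_log_mul_rpow_nhdsGT_zero one_pos)
  rw [Real.exp_zero] at h
  refine h.congr' ?_
  filter_upwards [self_mem_nhdsWithin] with t ht
  simp [Real.rpow_def_of_pos ht]

lemma tendsto_bmpPeakFactor {ι : Type*} {l : Filter ι} {a t : ι → ℝ}
    (ha : Tendsto a l (nhds 1)) (ht : Tendsto t l (nhdsWithin 0 (Ioi 0))) :
    Tendsto (fun i => bmpPeakFactor (a i) (t i)) l (nhds 1) := by
  have ht' : Tendsto t l (nhds 0) := ht.mono_right nhdsWithin_le_nhds
  have h1t : Tendsto (fun i => 1 - t i) l (nhds 1) := by simpa using ht'.const_sub 1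
  have h1 := h1t.rpow (ha.mul h1t) (Or.inl one_ne_zero)
  have h2 := (tendsto_rpow_self_nhdsGT_zero.comp ht).rpow ha (Or.inl one_ne_zero)
  have h3 := (Real.continuous_cos.tendsto _).comp ((ha.const_mul Real.pi).mul ht')
  simpa [bmpPeakFactor] using (h1.mul h2).mul h3

lemma setIntegral_Ioo_mul_rpow_neg {α : ℝ} (hα : α < 1) (g : ℝ → ℝ) :
    ∫ t in Ioo (0 : ℝ) 1, (1 - α) * (t ^ (-α) * g t) =
      ∫ s in Ioo (0 : ℝ) 1, g (s ^ (1 - α)⁻¹) := by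
  have hε : 0 < 1 - α := by linarith
  have h := integral_comp_rpow_Ioi
    ((Ioo (0 : ℝ) 1).indicator fun s => g (s ^ (1 - α)⁻¹)) hε.ne'
  have hI : Ioi (0 : ℝ) ∩ Ioo 0 1 = Ioo 0 1 := inter_eq_right.2 fun x hx => hx.1
  rw [setIntegral_indicator measurableSet_Ioo, hI] at h
  rw [← h, ← hI, ← setIntegral_indicator measurableSet_Ioo, hI]
  refine setIntegral_congr_fun measurableSet_Ioi fun t ht => ?_
  have ht : 0 < t := ht
  by_cases h1 : t < 1
  · have h2 : t ^ (1 - α) ∈ Ioo (0 : ℝ) 1 :=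
      ⟨Real.rpow_pos_of_pos ht _, Real.rpow_lt_one ht.le h1 hε⟩
    rw [indicator_of_mem (show t ∈ Ioo (0 : ℝ) 1 from ⟨ht, h1⟩), indicator_of_mem h2,
      Real.rpow_rpow_inv ht.le hε.ne', abs_of_pos hε, smul_eq_mul, mul_assoc]
    congr 3
    ring
  · have h2 : t ^ (1 - α) ∉ Ioo (0 : ℝ) 1 := fun h' =>
      h'.2.not_ge (Real.one_le_rpow (not_lt.1 h1) hε.le)
    rw [indicator_of_notMem fun h' => h1 h'.2, indicator_of_notMem h2, smul_zero]

lemma tendsto_inv_one_sub_atTop :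
    Tendsto (fun α : ℝ => (1 - α)⁻¹) (nhdsWithin 1 (Iio 1)) atTop := by
  refine tendsto_inv_nhdsGT_zero.comp (tendsto_nhdsWithin_iff.2 ⟨?_, ?_⟩)
  · have : Continuous fun α : ℝ => 1 - α := by fun_prop
    simpa using (this.tendsto 1).mono_left nhdsWithin_le_nhds
  · filter_upwards [self_mem_nhdsWithin] with α hα
    exact sub_pos.2 (mem_Iio.1 hα)

lemma eventually_mem_Ioo_zero_one :
    ∀ᶠ α : ℝ in nhdsWithin 1 (Iio 1), α ∈ Ioo (0 : ℝ) 1 :=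
  Ioo_mem_nhdsLT one_pos

lemma tendsto_integral_bmpPeak {f : ℝ → ℝ} (hf : Continuous f) {C : ℝ} (hC : ∀ t, |f t| ≤ C) :
    Tendsto (fun α : ℝ => ∫ t in Ioo (0 : ℝ) 1,
        (1 - α) * (t ^ (-α) * (bmpPeakFactor α t * f t)))
      (nhdsWithin 1 (Iio 1)) (nhds (f 0)) := by
  have hlim : Tendsto (fun α : ℝ => ∫ s in Ioo (0 : ℝ) 1,
      bmpPeakFactor α (s ^ (1 - α)⁻¹) * f (s ^ (1 - α)⁻¹))
      (nhdsWithin 1 (Iio 1)) (nhds (∫ _ in Ioo (0 : ℝ) 1, f 0)) := by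
    refine tendsto_integral_filter_of_dominated_convergence (fun _ => C) ?_ ?_ ?_ ?_
    · refine Eventually.of_forall fun α => Measurable.aestronglyMeasurable ?_
      have hm : Measurable fun s : ℝ => s ^ (1 - α)⁻¹ := by fun_prop
      exact ((measurable_bmpPeakFactor α).comp hm).mul (hf.measurable.comp hm)
    · filter_upwards [eventually_mem_Ioo_zero_one] with α hα
      filter_upwards [ae_restrict_mem measurableSet_Ioo] with s hs
      have hε : 0 < (1 - α)⁻¹ := inv_pos.2 (sub_pos.2 hα.2)
      rw [Real.norm_eq_abs, abs_mul, ← one_mul C]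
      exact mul_le_mul (abs_bmpPeakFactor_le_one hα.1.le
        ⟨Real.rpow_pos_of_pos hs.1 _, Real.rpow_lt_one hs.1.le hs.2 hε⟩) (hC _)
        (abs_nonneg _) zero_le_one
    · exact integrable_const _
    · filter_upwards [ae_restrict_mem measurableSet_Ioo] with s hs
      have h0 : Tendsto (fun α : ℝ => s ^ (1 - α)⁻¹) (nhdsWithin 1 (Iio 1))
          (nhdsWithin 0 (Ioi 0)) := by
        refine tendsto_nhdsWithin_iff.2 ⟨?_, Eventually.of_forall fun α =>
          Real.rpow_pos_of_pos hs.1 _⟩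
        exact (tendsto_rpow_atTop_of_base_lt_one s (by linarith [hs.1]) hs.2).comp
          tendsto_inv_one_sub_atTop
      simpa using (tendsto_bmpPeakFactor (tendsto_id.mono_left nhdsWithin_le_nhds) h0).mul
        ((hf.tendsto 0).comp (h0.mono_right nhdsWithin_le_nhds))
  have hval : ∫ _ in Ioo (0 : ℝ) 1, f 0 = f 0 := by simp
  rw [hval] at hlim
  refine hlim.congr' ?_
  filter_upwards [self_mem_nhdsWithin] with α hα
  exact (setIntegral_Ioo_mul_rpow_neg hα fun t => bmpPeakFactor α t * f t).symm

lemma integrableOn_bmpPeak {f : ℝ → ℝ} (hf : Continuous f) {C : ℝ} (hC : ∀ t, |f t| ≤ C)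
    {α : ℝ} (hα : α ∈ Ioo (0 : ℝ) 1) :
    IntegrableOn (fun t => t ^ (-α) * (bmpPeakFactor α t * f t)) (Ioo 0 1) := by
  have hint : IntegrableOn (fun t : ℝ => t ^ (-α)) (Ioo 0 1) :=
    ((intervalIntegrable_iff_integrableOn_Ioo_of_le zero_le_one).1
      (intervalIntegral.intervalIntegrable_rpow' (by linarith [hα.2])))
  refine Integrable.mul_bdd (c := C) hint
    ((measurable_bmpPeakFactor α).mul hf.measurable).aestronglyMeasurable ?_
  filter_upwards [ae_restrict_mem measurableSet_Ioo] with t ht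
  rw [Real.norm_eq_abs, abs_mul, ← one_mul C]
  exact mul_le_mul (abs_bmpPeakFactor_le_one hα.1.le ht) (hC _) (abs_nonneg _) zero_le_one

lemma abs_bmpRegular_sub_mul_le {f : ℝ → ℝ} {C : ℝ} (hC : ∀ t, |f t| ≤ C)
    {α t : ℝ} (hα : α ∈ Ioo (0 : ℝ) 1) (ht : t ∈ Ioo (0 : ℝ) 1) :
    ‖(bmpRegular α t - bmpRegular 1 t) * f t‖ ≤ (Real.pi + Real.pi) * C := by
  rw [Real.norm_eq_abs, abs_mul]
  refine mul_le_mul ((abs_sub _ _).trans (add_le_add ?_ ?_)) (hC t) (abs_nonneg _) (by positivity)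
  · exact abs_bmpRegular_le ⟨hα.1.le, hα.2.le⟩ ht
  · exact abs_bmpRegular_le ⟨zero_le_one, le_rfl⟩ ht

lemma aestronglyMeasurable_bmpRegular_sub_mul {f : ℝ → ℝ} (hf : Continuous f) (α : ℝ) :
    AEStronglyMeasurable (fun t => (bmpRegular α t - bmpRegular 1 t) * f t)
      (volume.restrict (Ioo 0 1)) :=
  (((measurable_bmpRegular α).sub (measurable_bmpRegular 1)).mul
    hf.measurable).aestronglyMeasurable

lemma integrableOn_bmpRegular_sub_mul {f : ℝ → ℝ} (hf : Continuous f) {C : ℝ}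
    (hC : ∀ t, |f t| ≤ C) {α : ℝ} (hα : α ∈ Ioo (0 : ℝ) 1) :
    IntegrableOn (fun t => (bmpRegular α t - bmpRegular 1 t) * f t) (Ioo 0 1) := by
  refine Integrable.mono' (integrable_const ((Real.pi + Real.pi) * C))
    (aestronglyMeasurable_bmpRegular_sub_mul hf α) ?_
  filter_upwards [ae_restrict_mem measurableSet_Ioo] with t ht
  exact abs_bmpRegular_sub_mul_le hC hα ht

lemma tendsto_integral_bmpRegular_sub_mul {f : ℝ → ℝ} (hf : Continuous f) {C : ℝ}
    (hC : ∀ t, |f t| ≤ C) :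
    Tendsto (fun α : ℝ => ∫ t in Ioo (0 : ℝ) 1, (bmpRegular α t - bmpRegular 1 t) * f t)
      (nhdsWithin 1 (Iio 1)) (nhds 0) := by
  suffices h : Tendsto
      (fun α : ℝ => ∫ t in Ioo (0 : ℝ) 1, (bmpRegular α t - bmpRegular 1 t) * f t)
      (nhdsWithin 1 (Iio 1)) (nhds (∫ _ in Ioo (0 : ℝ) 1, (0 : ℝ))) by
    rwa [integral_zero] at h
  refine tendsto_integral_filter_of_dominated_convergence
    (fun _ => (Real.pi + Real.pi) * C) ?_ ?_ ?_ ?_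
  · exact Eventually.of_forall (aestronglyMeasurable_bmpRegular_sub_mul hf)
  · filter_upwards [eventually_mem_Ioo_zero_one] with α hα
    filter_upwards [ae_restrict_mem measurableSet_Ioo] with t ht
    exact abs_bmpRegular_sub_mul_le hC hα ht
  · exact integrable_const _
  · filter_upwards [ae_restrict_mem measurableSet_Ioo] with t ht
    have h := (tendsto_bmpRegular ht).mono_left (nhdsWithin_le_nhds (s := Iio 1))
    simpa using (h.sub_const (bmpRegular 1 t)).mul_const (f t)

lemma setIntegral_Ioo_comp_one_sub (g : ℝ → ℝ) :
    ∫ t in Ioo (0 : ℝ) 1, g (1 - t) = ∫ x in Ioo (0 : ℝ) 1, g x := by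
  rw [← integral_Ioc_eq_integral_Ioo, ← integral_Ioc_eq_integral_Ioo,
    ← intervalIntegral.integral_of_le zero_le_one, ← intervalIntegral.integral_of_le zero_le_one]
  simp

lemma integral_bmpU_sub_mul_comp_one_sub {f : ℝ → ℝ} (hf : Continuous f) {C : ℝ}
    (hC : ∀ t, |f t| ≤ C) {α : ℝ} (hα : α ∈ Ioo (0 : ℝ) 1) :
    (1 / Real.pi) * ∫ t in Ioo (0 : ℝ) 1, (bmpU α (1 - t) - bmpU 1 (1 - t)) * f t =
      Real.sinc (Real.pi * (1 - α)) * (∫ t in Ioo (0 : ℝ) 1,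
        (1 - α) * (t ^ (-α) * (bmpPeakFactor α t * f t))) +
      (1 / Real.pi) * ∫ t in Ioo (0 : ℝ) 1, (bmpRegular α t - bmpRegular 1 t) * f t := by
  have hε : 1 - α ≠ 0 := (sub_pos.2 hα.2).ne'
  have hsplit : ∫ t in Ioo (0 : ℝ) 1, (bmpU α (1 - t) - bmpU 1 (1 - t)) * f t =
      ∫ t in Ioo (0 : ℝ) 1,
        (Real.sin (Real.pi * (1 - α)) * (t ^ (-α) * (bmpPeakFactor α t * f t)) +
          (bmpRegular α t - bmpRegular 1 t) * f t) := by
    refine setIntegral_congr_fun measurableSet_Ioo fun t ht => ?_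
    simp only [bmpU_one_sub _ ht, sub_self, mul_zero, Real.sin_zero, zero_mul, zero_add]
    ring
  rw [hsplit, integral_add ((integrableOn_bmpPeak hf hC hα).const_mul _)
    (integrableOn_bmpRegular_sub_mul hf hC hα), integral_const_mul, integral_const_mul,
    Real.sinc_of_ne_zero (mul_ne_zero Real.pi_ne_zero hε)]
  field_simp

lemma tendsto_integral_bmpU_sub_mul_comp_one_sub {f : ℝ → ℝ} (hf : Continuous f) {C : ℝ}
    (hC : ∀ t, |f t| ≤ C) :
    Tendsto (fun α : ℝ => (1 / Real.pi) *
        ∫ t in Ioo (0 : ℝ) 1, (bmpU α (1 - t) - bmpU 1 (1 - t)) * f t)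
      (nhdsWithin 1 (Iio 1)) (nhds (f 0)) := by
  have hsinc : Tendsto (fun α : ℝ => Real.sinc (Real.pi * (1 - α)))
      (nhdsWithin 1 (Iio 1)) (nhds 1) := by
    have h : Continuous fun α : ℝ => Real.sinc (Real.pi * (1 - α)) :=
      Real.continuous_sinc.comp (by fun_prop)
    simpa using (h.tendsto 1).mono_left nhdsWithin_le_nhds
  have h := (hsinc.mul (tendsto_integral_bmpPeak hf hC)).add
    ((tendsto_integral_bmpRegular_sub_mul hf hC).const_mul (1 / Real.pi))
  rw [one_mul, mul_zero, add_zero] at h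
  refine h.congr' ?_
  filter_upwards [eventually_mem_Ioo_zero_one] with α hα
  exact (integral_bmpU_sub_mul_comp_one_sub hf hC hα).symm

/-- With `w(α,x) = u(α,x) − u(1,x)`, for every continuous `φ : [0,1] → ℝ`,
`lim_{α→1⁻} (1/π) ∫_0^1 w(α,x) φ(x) dx = φ(1)`. -/
theorem stmt7 (φ : ℝ → ℝ) (hφ : ContinuousOn φ (Set.Icc 0 1)) :
    Filter.Tendsto
      (fun α : ℝ => (1 / Real.pi) * ∫ x in Set.Ioo (0 : ℝ) 1, (bmpU α x - bmpU 1 x) * φ x)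
      (nhdsWithin 1 (Set.Iio 1)) (nhds (φ 1)) := by
  let ψ : ℝ → ℝ := IccExtend (zero_le_one' ℝ) ((Icc 0 1).domRestrict φ)
  have hψ : Continuous ψ := hφ.domRestrict.Icc_extend'
  have hψφ : ∀ x ∈ Icc (0 : ℝ) 1, ψ x = φ x := fun x hx => IccExtend_of_mem _ _ hx
  obtain ⟨C, hC⟩ := isCompact_Icc.exists_bound_of_continuousOn hφ
  have hψC : ∀ x, |ψ x| ≤ C := fun x => hC _ (projIcc 0 1 (zero_le_one' ℝ) x).2
  have h := tendsto_integral_bmpU_sub_mul_comp_one_sub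
    (f := fun t => ψ (1 - t)) (hψ.comp (by fun_prop)) fun t => hψC (1 - t)
  rw [sub_zero, hψφ 1 (right_mem_Icc.2 zero_le_one)] at h
  refine h.congr fun α => ?_
  rw [setIntegral_Ioo_comp_one_sub fun x => (bmpU α x - bmpU 1 x) * ψ x]
  congr 1
  refine setIntegral_congr_fun measurableSet_Ioo fun x hx => ?_
  simp only [hψφ x (Ioo_subset_Icc_self hx)]
end
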